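/- arXiv:1604.05093 — 2 statements merged into one kernel-verified Lean document; each statement's English description precedes it below -/
import Mathlib

section
/- Let f : (0,∞) → ℝ be a non-affine subentropic function. Then the function g(t) = 1/f''(t), t > 0, is positive, infinitely differentiable and super-additive: g(t+s) ≥ g(t) + g(s) for all t, s > 0. -/
open scoped Matrix
open Matrix
open scoped ComplexOrder

noncomputable section

/-- The trace of `f` applied (by the functional calculus) to a Hermitian matrix,
computed via the eigenvalues.  Junk value `0` on non-Hermitian matrices. -/
def trFn (f : ℝ → ℝ) {d : Type} [Fintype d] [DecidableEq d] (ρ : Matrix d d ℂ) : ℝ :=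
  if hρ : ρ.IsHermitian then ∑ i, f (hρ.eigenvalues i) else 0

/-- `f` applied to a Hermitian matrix by the functional calculus (spectral theorem).
Junk value `0` on non-Hermitian matrices. -/
def matFn (f : ℝ → ℝ) {d : Type} [Fintype d] [DecidableEq d] (ρ : Matrix d d ℂ) :
    Matrix d d ℂ :=
  if hρ : ρ.IsHermitian then
    (hρ.eigenvectorUnitary : Matrix d d ℂ) *
      Matrix.diagonal (fun i => (f (hρ.eigenvalues i) : ℂ)) *
      star (hρ.eigenvectorUnitary : Matrix d d ℂ)
  else 0

/-- The partial trace over the second factor of a bipartite system `H₁ ⊗ H₂`,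
where operators on `H₁ ⊗ H₂` are modelled as matrices indexed by `Fin m × Fin n`. -/
def partialTrace {m n : ℕ} (ρ : Matrix (Fin m × Fin n) (Fin m × Fin n) ℂ) :
    Matrix (Fin m) (Fin m) ℂ :=
  Matrix.of fun i j => ∑ k : Fin n, ρ (i, k) (j, k)

/-- A convex function `f : (0,∞) → ℝ` is entropic if on every finite-dimensional
bipartite system the map `ρ ↦ -Tr f(ρ₁) + Tr f(ρ)` is convex in positive definite `ρ`,
where `ρ₁` is the partial trace of `ρ` on the first factor. -/
def IsEntropic (f : ℝ → ℝ) : Prop :=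
  ConvexOn ℝ (Set.Ioi (0 : ℝ)) f ∧
  ∀ m n : ℕ,
    ConvexOn ℝ {ρ : Matrix (Fin m × Fin n) (Fin m × Fin n) ℂ | ρ.PosDef}
      (fun ρ => - trFn f (partialTrace ρ) + trFn f ρ)

/-- A convex function `f : (0,∞) → ℝ` is subentropic of order `k` if
`G(ρ₁,…,ρ_k) = -Tr f(ρ₁+⋯+ρ_k) + Tr f(ρ₁) + ⋯ + Tr f(ρ_k)` is convex in `k`-tuples of
positive definite operators on any finite-dimensional Hilbert space. -/
def SubentropicOfOrder (f : ℝ → ℝ) (k : ℕ) : Prop :=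
  ConvexOn ℝ (Set.Ioi (0 : ℝ)) f ∧
  ∀ n : ℕ,
    ConvexOn ℝ {ρ : Fin k → Matrix (Fin n) (Fin n) ℂ | ∀ i, (ρ i).PosDef}
      (fun ρ => - trFn f (∑ i, ρ i) + ∑ i, trFn f (ρ i))

/-- A function is subentropic if it is subentropic of all orders. -/
def Subentropic (f : ℝ → ℝ) : Prop :=
  ∀ k : ℕ, SubentropicOfOrder f k

/-- Divided difference of `g`, with `g'` on the diagonal. -/
def divDiff (g : ℝ → ℝ) (x y : ℝ) : ℝ :=
  if x = y then deriv g x else (g x - g y) / (x - y)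

/-- Conjugation `h ↦ U * h * U*` as a linear operator on matrices. -/
def conjEnd {n : ℕ} (U : Matrix (Fin n) (Fin n) ℂ) :
    Module.End ℂ (Matrix (Fin n) (Fin n) ℂ) :=
  (LinearMap.mulLeft ℂ U).comp (LinearMap.mulRight ℂ (star U))

/-- Hadamard (entrywise) multiplication by a fixed matrix `L`, as a linear operator. -/
def hadamardEnd {n : ℕ} (L : Matrix (Fin n) (Fin n) ℂ) :
    Module.End ℂ (Matrix (Fin n) (Fin n) ℂ) where
  toFun h := L ⊙ h
  map_add' h₁ h₂ := Matrix.hadamard_add L h₁ h₂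
  map_smul' c h := Matrix.hadamard_smul L h c

/-- The Fréchet differential `dg(ρ)` of the matrix function induced by `g` at the
Hermitian matrix `ρ`: in a basis diagonalising `ρ` it acts as the Hadamard product
with the Löwner matrix of divided differences of `g`.  Junk value `0` at
non-Hermitian matrices. -/
def frechetDiff (g : ℝ → ℝ) {n : ℕ} (ρ : Matrix (Fin n) (Fin n) ℂ) :
    Module.End ℂ (Matrix (Fin n) (Fin n) ℂ) :=
  if hρ : ρ.IsHermitian then
    (conjEnd (hρ.eigenvectorUnitary : Matrix (Fin n) (Fin n) ℂ)).comp
      ((hadamardEnd (Matrix.of fun i j =>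
          (divDiff g (hρ.eigenvalues i) (hρ.eigenvalues j) : ℂ))).comp
        (conjEnd (star (hρ.eigenvectorUnitary : Matrix (Fin n) (Fin n) ℂ))))
  else 0

/-- The order, with respect to the trace inner product, between operators on `B(H)`:
`T ≤ S` iff `S - T` is a positive superoperator. -/
def endLE {n : ℕ} (T S : Module.End ℂ (Matrix (Fin n) (Fin n) ℂ)) : Prop :=
  ∀ h : Matrix (Fin n) (Fin n) ℂ, 0 ≤ Matrix.trace (star h * (S h - T h))

/-- The harmonic mean `H₂(A,B) = 2 (A⁻¹ + B⁻¹)⁻¹` of two (positive definite, hence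
invertible) operators on `B(H)`. -/
def harmonicMeanEnd {n : ℕ} (A B : Module.End ℂ (Matrix (Fin n) (Fin n) ℂ)) :
    Module.End ℂ (Matrix (Fin n) (Fin n) ℂ) :=
  (2 : ℂ) • Ring.inverse (Ring.inverse A + Ring.inverse B)

/-- The amplification `id_n ⊗ Φ` of a linear map on matrices. -/
def amplify {m k : ℕ} (Φ : Matrix (Fin m) (Fin m) ℂ →ₗ[ℂ] Matrix (Fin k) (Fin k) ℂ)
    (n : ℕ) (A : Matrix (Fin n × Fin m) (Fin n × Fin m) ℂ) :
    Matrix (Fin n × Fin k) (Fin n × Fin k) ℂ :=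
  Matrix.of fun p q => Φ (Matrix.of fun x y => A (p.1, x) (q.1, y)) p.2 q.2

/-- A linear map on matrices is completely positive if all its amplifications
preserve positive semidefiniteness. -/
def IsCompletelyPositive {m k : ℕ}
    (Φ : Matrix (Fin m) (Fin m) ℂ →ₗ[ℂ] Matrix (Fin k) (Fin k) ℂ) : Prop :=
  ∀ n : ℕ, ∀ A : Matrix (Fin n × Fin m) (Fin n × Fin m) ℂ,
    A.PosSemidef → (amplify Φ n A).PosSemidef

/-- A quantum channel is a completely positive trace preserving linear map. -/
def IsQuantumChannel {m k : ℕ}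
    (Φ : Matrix (Fin m) (Fin m) ℂ →ₗ[ℂ] Matrix (Fin k) (Fin k) ℂ) : Prop :=
  IsCompletelyPositive Φ ∧ ∀ A, (Φ A).trace = A.trace

/-- Weighted walks of length `b` from `0` to `j` on the half-line `ℕ`, where the edge `{j, j + 1}`
has weight `e j` and the loop at `0` has weight `r`. -/
def walk (e : ℕ → ℝ) (r : ℝ) : ℕ → ℕ → ℝ
  | 0, j => if j = 0 then 1 else 0
  | b + 1, j => (if j = 0 then r * walk e r b 0 else e (j - 1) * walk e r b (j - 1)) +
      e j * walk e r b (j + 1)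

/-- Edge weights `1` on the first `K` edges, `s` on the next one, and `0` beyond. -/
def edgeWeight (K : ℕ) (s : ℝ) (j : ℕ) : ℝ :=
  if j < K then 1 else if j = K then s else 0

/-- The weighted adjacency matrix of a path with a loop of weight `r` at its first vertex. -/
def pathMatrix (K : ℕ) (s r : ℝ) : Matrix (Fin (K + 2)) (Fin (K + 2)) ℝ :=
  Matrix.of fun i j =>
    (if (i : ℕ) = 0 then (if (j : ℕ) = 0 then r else 0)
      else if (j : ℕ) = i - 1 then edgeWeight K s (i - 1) else 0) +
    (if (j : ℕ) = i + 1 then edgeWeight K s i else 0)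

lemma walk_eq_zero (e : ℕ → ℝ) (r : ℝ) {b j : ℕ} (h : b < j) : walk e r b j = 0 := by
  induction b generalizing j with
  | zero => simp [walk, h.ne']
  | succ b ih =>
    rw [walk, if_neg (by omega), ih (by omega), ih (by omega)]
    simp

lemma walk_diag (K : ℕ) (s r : ℝ) {b : ℕ} (h : b ≤ K) :
    walk (edgeWeight K s) r b b = 1 := by
  induction b with
  | zero => simp [walk]
  | succ b ih =>
    rw [walk, if_neg (by omega), walk_eq_zero _ _ (by omega : b < b + 1 + 1)]
    simp [ih (by omega), edgeWeight, show b < K by omega]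

lemma walk_last (K : ℕ) (s r : ℝ) : walk (edgeWeight K s) r (K + 1) (K + 1) = s := by
  rw [walk, if_neg (by omega), walk_eq_zero _ _ (by omega : K < K + 1 + 1)]
  simp [walk_diag, edgeWeight]

lemma walk_eq_of_lt (K : ℕ) (s r : ℝ) {b j : ℕ} (h : b + j < 2 * (K + 1)) :
    walk (edgeWeight K s) r b j = walk (edgeWeight K 0) r b j := by
  induction b generalizing j with
  | zero => simp [walk]
  | succ b ih =>
    have h1 : edgeWeight K s j * walk (edgeWeight K s) r b (j + 1) =
        edgeWeight K 0 j * walk (edgeWeight K 0) r b (j + 1) := by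
      rcases lt_or_ge j K with hj | hj
      · rw [ih (by omega)]
        simp [edgeWeight, hj]
      · rw [walk_eq_zero _ _ (by omega), walk_eq_zero _ _ (by omega)]
        simp
    rw [walk, walk, h1]
    congr 1
    rcases Nat.eq_zero_or_pos j with rfl | hj
    · rw [if_pos rfl, if_pos rfl, ih (by omega)]
    · rw [if_neg hj.ne', if_neg hj.ne']
      rcases lt_or_ge (j - 1) K with hj' | hj'
      · rw [ih (by omega)]
        simp [edgeWeight, hj']
      · rw [walk_eq_zero _ _ (by omega), walk_eq_zero _ _ (by omega)]
        simp

lemma walk_sub_walk (K : ℕ) (s r : ℝ) {b j : ℕ} (hj : j ≤ K) (h : b + j = 2 * (K + 1)) :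
    walk (edgeWeight K s) r b j - walk (edgeWeight K 0) r b j = s ^ 2 := by
  induction b generalizing j with
  | zero => omega
  | succ b ih =>
    have h1 : (if j = 0 then r * walk (edgeWeight K s) r b 0 else
          edgeWeight K s (j - 1) * walk (edgeWeight K s) r b (j - 1)) =
        (if j = 0 then r * walk (edgeWeight K 0) r b 0 else
          edgeWeight K 0 (j - 1) * walk (edgeWeight K 0) r b (j - 1)) := by
      rcases Nat.eq_zero_or_pos j with rfl | hj0
      · rw [if_pos rfl, if_pos rfl, walk_eq_of_lt K s r (by omega)]
      · rw [if_neg hj0.ne', if_neg hj0.ne', walk_eq_of_lt K s r (by omega)]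
        simp [edgeWeight, show j - 1 < K by omega]
    rw [walk, walk, h1, add_sub_add_left_eq_sub]
    rcases hj.lt_or_eq with hj' | rfl
    · simp only [edgeWeight, hj', if_true, one_mul]
      exact ih (by omega) (by omega)
    · obtain rfl : b = j + 1 := by omega
      rw [walk_last]
      simp [edgeWeight, sq]

lemma pathMatrix_transpose (K : ℕ) (s r : ℝ) : (pathMatrix K s r)ᵀ = pathMatrix K s r := by
  ext i j
  simp only [pathMatrix, Matrix.transpose_apply, Matrix.of_apply]
  grind

lemma pathMatrix_pow_apply_zero (K : ℕ) (s r : ℝ) (b : ℕ) (i : Fin (K + 2)) :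
    (pathMatrix K s r ^ b) i 0 = walk (edgeWeight K s) r b i := by
  induction b generalizing i with
  | zero => simp only [pow_zero, Matrix.one_apply, walk, Fin.ext_iff, Fin.val_zero]
  | succ b ih =>
    rw [pow_succ', Matrix.mul_apply, walk]
    simp only [ih]
    simp only [pathMatrix, Matrix.of_apply, add_mul, Finset.sum_add_distrib]
    have hi := i.isLt
    congr 1
    · split_ifs with h
      · simp only [ite_mul, zero_mul]
        rw [Finset.sum_eq_single (0 : Fin (K + 2))
          (fun j _ hj => if_neg fun h' : (j : ℕ) = 0 => hj (Fin.ext h')) (by simp)]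
        simp
      · rw [Finset.sum_eq_single ⟨i - 1, by omega⟩
          (fun j _ hj => by rw [if_neg fun h' => hj (Fin.ext h'), zero_mul]) (by simp)]
        simp
    · by_cases h : (i : ℕ) + 1 < K + 2
      · rw [Finset.sum_eq_single ⟨i + 1, h⟩
          (fun j _ hj => by rw [if_neg fun h' => hj (Fin.ext h'), zero_mul]) (by simp)]
        simp
      · rw [Finset.sum_eq_zero fun j _ => by rw [if_neg (by omega), zero_mul]]
        simp [edgeWeight, show ¬ (i : ℕ) < K by omega, show ¬ (i : ℕ) = K by omega]

lemma pathMatrix_pow_zero_apply (K : ℕ) (s r : ℝ) (b : ℕ) (i : Fin (K + 2)) :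
    (pathMatrix K s r ^ b) 0 i = walk (edgeWeight K s) r b i := by
  rw [← pathMatrix_pow_apply_zero, ← Matrix.transpose_apply (pathMatrix K s r ^ b),
    Matrix.transpose_pow, pathMatrix_transpose]

lemma pathMatrix_sub (K : ℕ) (s r : ℝ) :
    pathMatrix K s r - pathMatrix K s 0 = Matrix.single 0 0 r := by
  ext i j
  simp only [pathMatrix, Matrix.sub_apply, Matrix.of_apply, Matrix.single_apply]
  have h1 : (0 : Fin (K + 2)) = i ↔ (i : ℕ) = 0 := by rw [Fin.ext_iff]; simp [eq_comm]
  have h2 : (0 : Fin (K + 2)) = j ↔ (j : ℕ) = 0 := by rw [Fin.ext_iff]; simp [eq_comm]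
  simp only [h1, h2]
  by_cases hi : (i : ℕ) = 0 <;> by_cases hj : (j : ℕ) = 0 <;> simp [hi, hj]

lemma pow_sub_pow_eq_sum {R : Type*} [Ring R] (X Y : R) (p : ℕ) :
    X ^ p - Y ^ p = ∑ k ∈ Finset.range p, X ^ k * (X - Y) * Y ^ (p - 1 - k) := by
  induction p with
  | zero => simp
  | succ p ih =>
    have h : X ^ (p + 1) - Y ^ (p + 1) = (X ^ p - Y ^ p) * Y + X ^ p * (X - Y) := by
      rw [pow_succ, pow_succ]; noncomm_ring
    rw [h, ih, Finset.sum_range_succ, Finset.sum_mul]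
    congr 1
    · refine Finset.sum_congr rfl fun k hk => ?_
      rw [Finset.mem_range] at hk
      rw [show p + 1 - 1 - k = (p - 1 - k) + 1 by omega, pow_succ, mul_assoc _ _ Y]
    · simp

lemma trace_pathMatrix_pow_sub (K : ℕ) (s : ℝ) (p : ℕ) :
    (pathMatrix K s 1 ^ p).trace - (pathMatrix K s 0 ^ p).trace =
      ∑ k ∈ Finset.range p, ∑ i : Fin (K + 2),
        walk (edgeWeight K s) 1 k i * walk (edgeWeight K s) 0 (p - 1 - k) i := by
  rw [← Matrix.trace_sub, pow_sub_pow_eq_sum, Matrix.trace_sum]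
  refine Finset.sum_congr rfl fun k _ => ?_
  rw [pathMatrix_sub, Matrix.trace_mul_cycle, Matrix.trace_mul_single]
  simp [Matrix.mul_apply, pathMatrix_pow_apply_zero, pathMatrix_pow_zero_apply, mul_comm]

lemma walk_mul_walk_eq (K : ℕ) (s : ℝ) {a b : ℕ} (h : a + b < 2 * (K + 1)) (j : ℕ) :
    walk (edgeWeight K s) 1 a j * walk (edgeWeight K s) 0 b j =
      walk (edgeWeight K 0) 1 a j * walk (edgeWeight K 0) 0 b j := by
  by_cases ha : a < j
  · simp [walk_eq_zero _ _ ha]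
  by_cases hb : b < j
  · simp [walk_eq_zero _ _ hb]
  rw [walk_eq_of_lt K s 1 (by omega), walk_eq_of_lt K s 0 (by omega)]

lemma walk_mul_walk_sub (K : ℕ) (s : ℝ) {a b : ℕ} (h : a + b = 2 * (K + 1)) {j : ℕ}
    (hj : j < K + 2) :
    walk (edgeWeight K s) 1 a j * walk (edgeWeight K s) 0 b j -
      walk (edgeWeight K 0) 1 a j * walk (edgeWeight K 0) 0 b j =
      if j = min a b then s ^ 2 else 0 := by
  by_cases ha : a < j
  · simp [walk_eq_zero _ _ ha, show ¬ j = min a b by omega]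
  by_cases hb : b < j
  · simp [walk_eq_zero _ _ hb, show ¬ j = min a b by omega]
  rcases lt_trichotomy a b with hab | rfl | hab
  · rw [min_eq_left hab.le, walk_eq_of_lt K s 1 (by omega), ← mul_sub]
    split_ifs with hja
    · subst hja
      rw [walk_sub_walk K s 0 (by omega) (by omega), walk_diag _ _ _ (by omega), one_mul]
    · rw [walk_eq_of_lt K s 0 (by omega), sub_self, mul_zero]
  · obtain rfl : a = K + 1 := by omega
    split_ifs with hja
    · rw [hja, min_self]
      simp only [walk_last]
      ring
    · rw [walk_eq_of_lt K s 1 (by omega), walk_eq_of_lt K s 0 (by omega), sub_self]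
  · rw [min_eq_right hab.le, walk_eq_of_lt K s 0 (by omega), ← sub_mul]
    split_ifs with hja
    · subst hja
      rw [walk_sub_walk K s 1 (by omega) (by omega), walk_diag _ _ _ (by omega), mul_one]
    · rw [walk_eq_of_lt K s 1 (by omega), sub_self, zero_mul]

/-- Second difference in the last edge weight of the first difference in the loop weight of
the `p`-th moment of the path matrix. -/
lemma trace_pathMatrix_pow_diff (K : ℕ) (s : ℝ) {p : ℕ} (hp : p ≤ 2 * K + 3) :
    ((pathMatrix K s 1 ^ p).trace - (pathMatrix K s 0 ^ p).trace) -
      ((pathMatrix K 0 1 ^ p).trace - (pathMatrix K 0 0 ^ p).trace) =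
      if p = 2 * K + 3 then (2 * K + 3) * s ^ 2 else 0 := by
  rw [trace_pathMatrix_pow_sub, trace_pathMatrix_pow_sub]
  split_ifs with h
  · subst h
    simp only [← Finset.sum_sub_distrib]
    have : ∀ k ∈ Finset.range (2 * K + 3), ∑ i : Fin (K + 2),
        (walk (edgeWeight K s) 1 k i * walk (edgeWeight K s) 0 (2 * K + 3 - 1 - k) i -
          walk (edgeWeight K 0) 1 k i * walk (edgeWeight K 0) 0 (2 * K + 3 - 1 - k) i) =
        s ^ 2 := by
      intro k hk
      rw [Finset.mem_range] at hk
      have hm : min k (2 * K + 3 - 1 - k) < K + 2 := by omega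
      rw [Finset.sum_congr rfl fun i _ => walk_mul_walk_sub K s
        (by omega : k + (2 * K + 3 - 1 - k) = 2 * (K + 1)) i.isLt,
        Finset.sum_eq_single ⟨_, hm⟩ (fun j _ hj => if_neg fun h' => hj (Fin.ext h')) (by simp)]
      simp
    rw [Finset.sum_congr rfl this]
    simp
  · rw [sub_eq_zero]
    refine Finset.sum_congr rfl fun k hk => Finset.sum_congr rfl fun i _ => ?_
    rw [Finset.mem_range] at hk
    exact walk_mul_walk_eq K s (by omega) i
section FunctionalCalculus

variable {d : Type} [Fintype d] [DecidableEq d]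

lemma trFn_conjStarAlgAut_diagonal (f : ℝ → ℝ) (U : Matrix.unitaryGroup d ℂ) (x : d → ℝ)
    {A : Matrix d d ℂ}
    (h : A = Unitary.conjStarAlgAut ℂ _ U (Matrix.diagonal fun i => (x i : ℂ))) :
    trFn f A = ∑ i, f (x i) := by
  have hA : A.IsHermitian := by
    rw [h, Matrix.IsHermitian, ← Matrix.star_eq_conjTranspose, ← map_star,
      Matrix.star_eq_conjTranspose, Matrix.diagonal_conjTranspose]
    congr 2
    ext i
    simp
  have hchar : A.charpoly = ∏ i, (Polynomial.X - Polynomial.C (x i : ℂ)) := by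
    rw [h, Unitary.conjStarAlgAut_apply, Matrix.charpoly_mul_comm, ← mul_assoc]
    simp [Matrix.charpoly_diagonal]
  have hroots : Multiset.map (fun i => (hA.eigenvalues i : ℂ)) Finset.univ.val =
      Multiset.map (fun i => (x i : ℂ)) Finset.univ.val := by
    have h1 := hA.roots_charpoly_eq_eigenvalues
    rw [hchar, Polynomial.roots_prod _ _
      (Finset.prod_ne_zero_iff.2 fun i _ => Polynomial.X_sub_C_ne_zero _)] at h1
    simp only [Polynomial.roots_X_sub_C, Multiset.bind_singleton] at h1
    exact h1.symm
  have h2 := congrArg (fun s : Multiset ℂ => (s.map fun z => f z.re).sum) hroots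
  simp only [Multiset.map_map, Function.comp_def, Complex.ofReal_re] at h2
  rw [trFn, dif_pos hA]
  exact h2

lemma smul_one_add_smul_eq {H : Matrix d d ℂ} (hH : H.IsHermitian) (t ε : ℝ) :
    t • (1 : Matrix d d ℂ) + ε • H = Unitary.conjStarAlgAut ℂ _ hH.eigenvectorUnitary
      (Matrix.diagonal fun i => ((t + ε * hH.eigenvalues i : ℝ) : ℂ)) := by
  have h : (Matrix.diagonal fun i => ((t + ε * hH.eigenvalues i : ℝ) : ℂ)) =
      (t : ℂ) • (1 : Matrix d d ℂ) +
        (ε : ℂ) • Matrix.diagonal (RCLike.ofReal ∘ hH.eigenvalues) := by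
    ext i j
    by_cases hij : i = j
    · subst hij; simp
    · simp [hij]
  rw [h, map_add, map_smul, map_smul, map_one, ← hH.spectral_theorem]
  rfl

lemma trFn_smul_one_add_smul (f : ℝ → ℝ) {H : Matrix d d ℂ} (hH : H.IsHermitian) (t ε : ℝ) :
    trFn f (t • (1 : Matrix d d ℂ) + ε • H) = ∑ i, f (t + ε * hH.eigenvalues i) :=
  trFn_conjStarAlgAut_diagonal f _ _ (smul_one_add_smul_eq hH t ε)

lemma posDef_smul_one_add_smul {H : Matrix d d ℂ} (hH : H.IsHermitian) {t ε : ℝ}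
    (h : ∀ i, 0 < t + ε * hH.eigenvalues i) : (t • (1 : Matrix d d ℂ) + ε • H).PosDef := by
  rw [smul_one_add_smul_eq hH, Unitary.conjStarAlgAut_apply,
    Unitary.isUnit_coe.posDef_star_right_conjugate_iff, Matrix.posDef_diagonal_iff]
  exact fun i => by exact_mod_cast h i

lemma sum_eigenvalues_pow {H : Matrix d d ℂ} (hH : H.IsHermitian) (p : ℕ) :
    ((∑ i, hH.eigenvalues i ^ p : ℝ) : ℂ) = (H ^ p).trace := by
  have h : H ^ p = Unitary.conjStarAlgAut ℂ _ hH.eigenvectorUnitary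
      (Matrix.diagonal (RCLike.ofReal ∘ hH.eigenvalues) ^ p) := by
    rw [map_pow, ← hH.spectral_theorem]
  rw [h, Unitary.conjStarAlgAut_apply, Matrix.trace_mul_comm, ← mul_assoc,
    Unitary.coe_star_mul_self, one_mul, Matrix.diagonal_pow, Matrix.trace_diagonal]
  simp

end FunctionalCalculus

/-- The path matrix viewed as a complex matrix. -/
def pathMatrixC (K : ℕ) (s r : ℝ) : Matrix (Fin (K + 2)) (Fin (K + 2)) ℂ :=
  (pathMatrix K s r).map (algebraMap ℝ ℂ)

lemma pathMatrixC_isHermitian (K : ℕ) (s r : ℝ) : (pathMatrixC K s r).IsHermitian := by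
  ext i j
  have h := congrFun (congrFun (pathMatrix_transpose K s r) i) j
  simp only [Matrix.transpose_apply] at h
  simp [pathMatrixC, h]

/-- The eigenvalues of the path matrix. -/
def pathEigenvalues (K : ℕ) (s r : ℝ) : Fin (K + 2) → ℝ :=
  (pathMatrixC_isHermitian K s r).eigenvalues

lemma sum_pathEigenvalues_pow (K : ℕ) (s r : ℝ) (p : ℕ) :
    ∑ i, pathEigenvalues K s r i ^ p = (pathMatrix K s r ^ p).trace := by
  have h := sum_eigenvalues_pow (pathMatrixC_isHermitian K s r) p
  have h2 : (pathMatrixC K s r ^ p) = (pathMatrix K s r ^ p).map (algebraMap ℝ ℂ) := by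
    rw [pathMatrixC, Matrix.map_pow]
  have h3 := AddMonoidHom.map_trace (algebraMap ℝ ℂ) (pathMatrix K s r ^ p)
  rw [h2, ← h3] at h
  exact Complex.ofReal_injective h

lemma Subentropic.path_ineq_of_pos {f : ℝ → ℝ} (hf : Subentropic f) (K : ℕ) {t ε η : ℝ}
    (hε : 0 < ε) (hη : 0 < η) (h1 : ∀ i, 0 < t + ε * pathEigenvalues K 1 0 i)
    (h2 : ∀ i, 0 < t + ε * pathEigenvalues K (-1) 0 i) :
    0 ≤ ∑ i, f (t + ε * pathEigenvalues K 1 0 i) + ∑ i, f (t + ε * pathEigenvalues K (-1) 0 i) -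
      2 * ∑ i, f (t + ε * pathEigenvalues K 0 0 i) -
      ∑ i, f (t + ε * η + ε * pathEigenvalues K 1 1 i) -
      ∑ i, f (t + ε * η + ε * pathEigenvalues K (-1) 1 i) +
      2 * ∑ i, f (t + ε * η + ε * pathEigenvalues K 0 1 i) := by
  set σ : Matrix (Fin (K + 2)) (Fin (K + 2)) ℂ :=
    Matrix.diagonal fun i => ((ε * (η + if i = 0 then 1 else 0) : ℝ) : ℂ) with hσ
  have hσpos : σ.PosDef := by
    rw [hσ, Matrix.posDef_diagonal_iff]
    intro i
    have : (0 : ℝ) < ε * (η + if i = 0 then 1 else 0) := by split_ifs <;> positivity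
    exact_mod_cast this
  set P : ℝ → ℝ → ℝ → Matrix (Fin (K + 2)) (Fin (K + 2)) ℂ :=
    fun u s r => u • (1 : Matrix _ _ ℂ) + ε • pathMatrixC K s r with hP
  have hadd : ∀ s, P t s 0 + σ = P (t + ε * η) s 1 := by
    intro s
    ext i j
    have h := congrFun (congrFun (pathMatrix_sub K s 1) i) j
    rw [Matrix.sub_apply, sub_eq_iff_eq_add, Matrix.single_apply] at h
    simp only [hP, hσ, Matrix.add_apply, Matrix.smul_apply, pathMatrixC, Matrix.map_apply, h,
      Matrix.one_apply, Matrix.diagonal_apply]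
    by_cases hij : i = j
    · subst hij
      by_cases hi : i = 0
      · simp [hi]; ring
      · simp [hi, Ne.symm hi]; ring
    · have : ¬ (0 = i ∧ 0 = j) := fun h => hij (h.1.symm.trans h.2)
      simp [hij, this]
  have hmid : (1 / 2 : ℝ) • P t 1 0 + (1 / 2 : ℝ) • P t (-1) 0 = P t 0 0 := by
    have h : pathMatrix K 1 0 + pathMatrix K (-1) 0 = (2 : ℝ) • pathMatrix K 0 0 := by
      ext i j
      simp only [pathMatrix, Matrix.add_apply, Matrix.smul_apply, Matrix.of_apply, edgeWeight,
        smul_eq_mul]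
      split_ifs <;> norm_num
    ext i j
    have h' := congrFun (congrFun h i) j
    simp only [Matrix.add_apply, Matrix.smul_apply, smul_eq_mul] at h'
    have h'' : (pathMatrix K 1 0 i j : ℂ) + pathMatrix K (-1) 0 i j = 2 * pathMatrix K 0 0 i j := by
      exact_mod_cast h'
    simp only [hP, Matrix.add_apply, Matrix.smul_apply, pathMatrixC, Matrix.map_apply,
      Complex.coe_algebraMap, Complex.real_smul]
    push_cast
    linear_combination (ε / 2 : ℂ) * h''
  have hx : ∀ i, ((![P t 1 0, σ] : Fin 2 → _) i).PosDef :=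
    Fin.forall_fin_two.2 ⟨posDef_smul_one_add_smul _ h1, hσpos⟩
  have hy : ∀ i, ((![P t (-1) 0, σ] : Fin 2 → _) i).PosDef :=
    Fin.forall_fin_two.2 ⟨posDef_smul_one_add_smul _ h2, hσpos⟩
  have hconv := ((hf 2).2 (K + 2)).2 hx hy (by norm_num : (0 : ℝ) ≤ 1 / 2)
    (by norm_num : (0 : ℝ) ≤ 1 / 2) (by norm_num)
  have hσmid : (1 / 2 : ℝ) • σ + (1 / 2 : ℝ) • σ = σ := by
    rw [← add_smul]; norm_num
  have hT : ∀ u s r, trFn f (P u s r) = ∑ i, f (u + ε * pathEigenvalues K s r i) :=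
    fun u s r => trFn_smul_one_add_smul f (pathMatrixC_isHermitian K s r) u ε
  simp only [Fin.sum_univ_two, Pi.add_apply, Pi.smul_apply, Matrix.cons_val_zero,
    Matrix.cons_val_one, hmid, hσmid, hadd, hT, smul_eq_mul] at hconv
  linarith

lemma Subentropic.continuousOn {f : ℝ → ℝ} (hf : Subentropic f) :
    ContinuousOn f (Set.Ioi 0) :=
  (hf 0).1.continuousOn isOpen_Ioi

lemma Subentropic.path_ineq {f : ℝ → ℝ} (hf : Subentropic f) (K : ℕ) {t ε : ℝ}
    (hε : 0 < ε) (h : ∀ s r i, (s = 1 ∨ s = -1 ∨ s = 0) → (r = 0 ∨ r = 1) →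
      0 < t + ε * pathEigenvalues K s r i) :
    0 ≤ ∑ i, f (t + ε * pathEigenvalues K 1 0 i) + ∑ i, f (t + ε * pathEigenvalues K (-1) 0 i) -
      2 * ∑ i, f (t + ε * pathEigenvalues K 0 0 i) -
      ∑ i, f (t + ε * pathEigenvalues K 1 1 i) -
      ∑ i, f (t + ε * pathEigenvalues K (-1) 1 i) +
      2 * ∑ i, f (t + ε * pathEigenvalues K 0 1 i) := by
  have hlim : ∀ s, (s = 1 ∨ s = -1 ∨ s = 0) →
      Filter.Tendsto (fun η : ℝ => ∑ i, f (t + ε * η + ε * pathEigenvalues K s 1 i))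
      (nhdsWithin 0 (Set.Ioi 0)) (nhds (∑ i, f (t + ε * pathEigenvalues K s 1 i))) := by
    intro s hs
    refine tendsto_finsetSum _ fun i _ => ?_
    have hc := hf.continuousOn.continuousAt (Ioi_mem_nhds (h s 1 i hs (Or.inr rfl)))
    refine hc.tendsto.comp ?_
    have : Continuous fun η : ℝ => t + ε * η + ε * pathEigenvalues K s 1 i := by fun_prop
    refine (this.tendsto' 0 _ (by simp)).mono_left nhdsWithin_le_nhds
  refine ge_of_tendsto (((tendsto_const_nhds.sub (hlim 1 (by simp))).sub
    (hlim (-1) (by simp))).add ((hlim 0 (by simp)).const_mul 2)) ?_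
  filter_upwards [self_mem_nhdsWithin] with η hη
  exact hf.path_ineq_of_pos K hε hη (fun i => h 1 0 i (by simp) (by simp))
    (fun i => h (-1) 0 i (by simp) (by simp))

/-- For every odd order `2 * K + 3` there is a finite difference functional of exactly this order
which is nonnegative on all subentropic functions. -/
lemma exists_difference_functional (K : ℕ) :
    ∃ w x : Fin 6 × Fin (K + 2) → ℝ, (∀ p < 2 * K + 3, ∑ i, w i * x i ^ p = 0) ∧
      ∑ i, w i * x i ^ (2 * K + 3) < 0 ∧
      ∀ f : ℝ → ℝ, Subentropic f → ∀ t ε : ℝ, 0 < ε → (∀ i, 0 < t + ε * x i) →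
        0 ≤ ∑ i, w i * f (t + ε * x i) := by
  set c : Fin 6 → ℝ := ![1, 1, -2, -1, -1, 2] with hc
  set e : Fin 6 → Fin (K + 2) → ℝ := ![pathEigenvalues K 1 0, pathEigenvalues K (-1) 0,
    pathEigenvalues K 0 0, pathEigenvalues K 1 1, pathEigenvalues K (-1) 1,
    pathEigenvalues K 0 1] with he
  have hsum : ∀ φ : ℝ → ℝ, ∑ i : Fin 6 × Fin (K + 2), c i.1 * φ (e i.1 i.2) =
      ∑ i, φ (pathEigenvalues K 1 0 i) + ∑ i, φ (pathEigenvalues K (-1) 0 i) -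
      2 * ∑ i, φ (pathEigenvalues K 0 0 i) - ∑ i, φ (pathEigenvalues K 1 1 i) -
      ∑ i, φ (pathEigenvalues K (-1) 1 i) + 2 * ∑ i, φ (pathEigenvalues K 0 1 i) := by
    intro φ
    rw [Fintype.sum_prod_type, Fin.sum_univ_six]
    simp only [hc, he, ← Finset.mul_sum]
    simp
    ring
  have hmom : ∀ p ≤ 2 * K + 3, ∑ i : Fin 6 × Fin (K + 2), c i.1 * e i.1 i.2 ^ p =
      if p = 2 * K + 3 then -2 * (2 * K + 3 : ℝ) else 0 := by
    intro p hp
    rw [hsum fun y => y ^ p]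
    simp only [sum_pathEigenvalues_pow]
    have h1 := trace_pathMatrix_pow_diff K 1 hp
    have h2 := trace_pathMatrix_pow_diff K (-1) hp
    split_ifs at h1 h2 ⊢ <;> linarith
  refine ⟨fun i => c i.1, fun i => e i.1 i.2, fun p hp => ?_, ?_, fun f hf t ε hε hpos => ?_⟩
  · rw [hmom p hp.le, if_neg hp.ne]
  · rw [hmom _ le_rfl, if_pos rfl]
    have : (0 : ℝ) ≤ K := K.cast_nonneg
    linarith
  · rw [hsum fun y => f (t + ε * y)]
    refine hf.path_ineq K hε ?_
    rintro s r i (rfl | rfl | rfl) (rfl | rfl)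
    exacts [hpos (0, i), hpos (3, i), hpos (1, i), hpos (4, i), hpos (2, i), hpos (5, i)]

open Filter Topology Asymptotics in
lemma tendsto_sum_div_pow {ι : Type*} [Fintype ι] {w x : ι → ℝ} {N : ℕ}
    (hw : ∀ p < N, ∑ i, w i * x i ^ p = 0) {u : ℝ → ℝ} {s : Set ℝ} (hs : IsOpen s)
    (hs' : Convex ℝ s) (hu : ContDiffOn ℝ N u s) {t : ℝ} (ht : t ∈ s) :
    Tendsto (fun ε : ℝ => (∑ i, w i * u (t + ε * x i)) / ε ^ N) (𝓝[>] 0)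
      (𝓝 ((N.factorial : ℝ)⁻¹ * ((∑ i, w i * x i ^ N) * iteratedDeriv N u t))) := by
  have hT : ∀ y, taylorWithinEval u N s t y =
      ∑ k ∈ Finset.range (N + 1), ((k.factorial : ℝ)⁻¹ * (y - t) ^ k) * iteratedDeriv k u t := by
    intro y
    rw [taylor_within_apply]
    refine Finset.sum_congr rfl fun k _ => ?_
    rw [iteratedDerivWithin_of_isOpen hs ht, smul_eq_mul]
  have ho := taylor_isLittleO hs' ht hu
  rw [hs.nhdsWithin_eq ht] at ho
  have hi : ∀ i, (fun ε => w i * (u (t + ε * x i) - taylorWithinEval u N s t (t + ε * x i)))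
      =o[𝓝[>] (0 : ℝ)] fun ε => ε ^ N := by
    intro i
    have hlim : Tendsto (fun ε : ℝ => t + ε * x i) (𝓝[>] 0) (𝓝 t) := by
      have : Continuous fun ε : ℝ => t + ε * x i := by fun_prop
      exact (this.tendsto' 0 t (by simp)).mono_left nhdsWithin_le_nhds
    refine ((ho.comp_tendsto hlim).trans_isBigO ?_).const_mul_left _
    refine IsBigO.of_bound (|x i| ^ N) (Eventually.of_forall fun ε => le_of_eq ?_)
    simp [mul_pow, mul_comm]
  have hsum := IsLittleO.sum fun i (_ : i ∈ Finset.univ) => hi i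
  have hpoly : ∀ ε : ℝ, ∑ i, w i * taylorWithinEval u N s t (t + ε * x i) =
      ε ^ N * ((N.factorial : ℝ)⁻¹ * ((∑ i, w i * x i ^ N) * iteratedDeriv N u t)) := by
    intro ε
    simp only [hT, add_sub_cancel_left, Finset.mul_sum]
    rw [Finset.sum_comm, Finset.sum_range_succ, Finset.sum_eq_zero]
    · simp only [zero_add, Finset.sum_mul, Finset.mul_sum]
      exact Finset.sum_congr rfl fun i _ => by ring
    · intro k hk
      calc _ = ε ^ k * (k.factorial : ℝ)⁻¹ * iteratedDeriv k u t * ∑ i, w i * x i ^ k := by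
            rw [Finset.mul_sum]
            exact Finset.sum_congr rfl fun i _ => by ring
        _ = 0 := by rw [hw k (Finset.mem_range.1 hk), mul_zero]
  set A := (N.factorial : ℝ)⁻¹ * ((∑ i, w i * x i ^ N) * iteratedDeriv N u t) with hA
  have hlim := hsum.tendsto_div_nhds_zero
  have := hlim.add_const A
  rw [zero_add] at this
  refine this.congr' ?_
  filter_upwards [self_mem_nhdsWithin] with ε hε
  have hε' : ε ^ N ≠ 0 := (pow_pos hε N).ne'
  simp only [Finset.sum_apply, mul_sub, Finset.sum_sub_distrib, hpoly]
  field_simp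
  ring

open Filter Topology in
lemma mul_iteratedDeriv_nonneg_of_sum_nonneg {ι : Type*} [Fintype ι] {w x : ι → ℝ} {N : ℕ}
    (hw : ∀ p < N, ∑ i, w i * x i ^ p = 0) {u : ℝ → ℝ} {s : Set ℝ} (hs : IsOpen s)
    (hs' : Convex ℝ s) (hu : ContDiffOn ℝ N u s) {t : ℝ} (ht : t ∈ s)
    (h : ∀ᶠ ε in 𝓝[>] (0 : ℝ), 0 ≤ ∑ i, w i * u (t + ε * x i)) :
    0 ≤ (∑ i, w i * x i ^ N) * iteratedDeriv N u t := by
  have hfac : (0 : ℝ) < (N.factorial : ℝ)⁻¹ := by positivity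
  refine nonneg_of_mul_nonneg_right (ge_of_tendsto (tendsto_sum_div_pow hw hs hs' hu ht) ?_) hfac
  filter_upwards [h, self_mem_nhdsWithin] with ε h1 hε
  exact div_nonneg h1 (pow_pos hε N).le

open Filter Topology MeasureTheory Convolution ContinuousLinearMap in
lemma sum_mul_convolution_nonneg {ι : Type*} [Fintype ι] {w x : ι → ℝ} {F : ℝ → ℝ}
    (hF : Continuous F) (φ : ContDiffBump (0 : ℝ)) {y ε : ℝ}
    (h : ∀ τ, |τ| < φ.rOut → 0 ≤ ∑ i, w i * F (y - τ + ε * x i)) :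
    0 ≤ ∑ i, w i * (φ.normed volume ⋆[lsmul ℝ ℝ, volume] F) (y + ε * x i) := by
  have hint : ∀ z, Integrable (fun τ => φ.normed volume τ * F (z - τ)) := by
    intro z
    refine Continuous.integrable_of_hasCompactSupport ?_ ?_
    · exact φ.continuous_normed.mul (hF.comp (continuous_const.sub continuous_id))
    · exact φ.hasCompactSupport_normed.mul_right
  have heq : ∑ i, w i * (φ.normed volume ⋆[lsmul ℝ ℝ, volume] F) (y + ε * x i) =
      ∫ τ, φ.normed volume τ * ∑ i, w i * F (y - τ + ε * x i) := by
    simp only [convolution_def, lsmul_apply, smul_eq_mul, ← integral_const_mul]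
    rw [← integral_finsetSum _ fun i _ => (hint _).const_mul _]
    congr 1
    ext τ
    rw [Finset.mul_sum]
    refine Finset.sum_congr rfl fun i _ => ?_
    rw [show y + ε * x i - τ = y - τ + ε * x i by ring]
    ring
  rw [heq]
  refine integral_nonneg fun τ => ?_
  by_cases hτ : |τ| < φ.rOut
  · exact mul_nonneg (φ.nonneg_normed τ) (h τ hτ)
  · have : φ.normed volume τ = 0 := by
      by_contra h0
      have h1 : τ ∈ Function.support (φ.normed volume) := h0
      rw [φ.support_normed_eq, mem_ball_zero_iff] at h1
      exact hτ h1
    simp [this]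

open Filter Topology MeasureTheory Convolution ContinuousLinearMap in
lemma mul_iteratedDeriv_convolution_nonneg {ι : Type*} [Fintype ι] {w x : ι → ℝ} {N : ℕ}
    (hw : ∀ p < N, ∑ i, w i * x i ^ p = 0) {f F : ℝ → ℝ} {a : ℝ}
    (ha : 0 < a) (hF : Continuous F) (hFf : ∀ y > a, F y = f y)
    (hf : ∀ t ε : ℝ, 0 < ε → (∀ i, 0 < t + ε * x i) → 0 ≤ ∑ i, w i * f (t + ε * x i))
    (φ : ContDiffBump (0 : ℝ)) {y : ℝ} (hy : a + φ.rOut < y) :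
    0 ≤ (∑ i, w i * x i ^ N) *
      iteratedDeriv N (φ.normed volume ⋆[lsmul ℝ ℝ, volume] F) y := by
  have hsm : ContDiff ℝ N (φ.normed volume ⋆[lsmul ℝ ℝ, volume] F) :=
    φ.hasCompactSupport_normed.contDiff_convolution_left _ φ.contDiff_normed
      hF.locallyIntegrable
  refine mul_iteratedDeriv_nonneg_of_sum_nonneg hw isOpen_univ convex_univ hsm.contDiffOn
    (Set.mem_univ y) ?_
  have hev : ∀ᶠ ε in 𝓝[>] (0 : ℝ), ∀ i, a + φ.rOut < y + ε * x i := by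
    refine eventually_all.2 fun i => ?_
    have : Continuous fun ε : ℝ => y + ε * x i := by fun_prop
    exact ((this.tendsto' 0 y (by simp)).mono_left nhdsWithin_le_nhds).eventually_const_lt hy
  filter_upwards [hev, self_mem_nhdsWithin] with ε hε hε0
  refine sum_mul_convolution_nonneg hF φ fun τ hτ => ?_
  have hlt : ∀ i, a < y - τ + ε * x i := fun i => by
    have := hε i
    have := (abs_lt.1 hτ).2
    linarith
  simp only [hFf _ (hlt _)]
  exact hf _ _ hε0 fun i => ha.trans (hlt i)

lemma sum_secondDiff (u : ℝ → ℝ) (t ε : ℝ) :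
    ∑ i, (![1, 1, -2] : Fin 3 → ℝ) i * u (t + ε * (![1, -1, 0] : Fin 3 → ℝ) i) =
      u (t + ε) + u (t - ε) - 2 * u t := by
  simp [Fin.sum_univ_three, sub_eq_add_neg]

lemma secondDiff_moment : ∀ p < 2,
    ∑ i, (![1, 1, -2] : Fin 3 → ℝ) i * (![1, -1, 0] : Fin 3 → ℝ) i ^ p = 0 := by
  intro p hp
  interval_cases p <;> simp [Fin.sum_univ_three]
  norm_num

lemma secondDiff_moment_two :
    ∑ i, (![1, 1, -2] : Fin 3 → ℝ) i * (![1, -1, 0] : Fin 3 → ℝ) i ^ 2 = 2 := by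
  simp [Fin.sum_univ_three]; norm_num

lemma ConvexOn.secondDiff_nonneg {f : ℝ → ℝ} {s : Set ℝ} (hf : ConvexOn ℝ s f) {t ε : ℝ}
    (h1 : t + ε ∈ s) (h2 : t - ε ∈ s) : 0 ≤ f (t + ε) + f (t - ε) - 2 * f t := by
  have := hf.2 h1 h2 (by norm_num : (0 : ℝ) ≤ 1 / 2) (by norm_num : (0 : ℝ) ≤ 1 / 2) (by norm_num)
  simp only [smul_eq_mul] at this
  rw [show (1 / 2 : ℝ) * (t + ε) + 1 / 2 * (t - ε) = t by ring] at this
  linarith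

lemma nonneg_of_deriv_nonpos_of_antitone {v v' v'' : ℝ → ℝ} {c : ℝ}
    (h1 : ∀ y > c, HasDerivAt v (v' y) y) (h2 : ∀ y > c, HasDerivAt v' (v'' y) y)
    (hv : ∀ y > c, 0 ≤ v y) (hv' : ∀ y > c, v' y ≤ 0) (ha : AntitoneOn v'' (Set.Ioi c)) :
    ∀ y > c, 0 ≤ v'' y := by
  intro p hp
  by_contra! hneg
  have hle : ∀ t, p ≤ t → v' t ≤ v'' p * (t - p) := by
    intro t ht
    have := (convex_Ici p).image_sub_le_mul_sub_of_deriv_le (f := v')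
      (fun y hy => (h2 y (lt_of_lt_of_le hp hy)).continuousAt.continuousWithinAt)
      (fun y hy => (h2 y (lt_of_lt_of_le hp (interior_subset hy))).differentiableAt.differentiableWithinAt)
      (C := v'' p) (fun y hy => by
        have hy' : p ≤ y := interior_subset hy
        rw [(h2 y (lt_of_lt_of_le hp hy')).deriv]
        exact ha hp (lt_of_lt_of_le hp hy') hy') p (Set.mem_Ici.2 le_rfl) t ht ht
    linarith [hv' p hp]
  have hle' : ∀ t, p + 1 ≤ t → v t ≤ v (p + 1) + v'' p * (t - (p + 1)) := by
    intro t ht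
    have hc : ∀ y, p + 1 ≤ y → c < y := fun y hy => by linarith [show c < p from hp]
    have := (convex_Ici (p + 1)).image_sub_le_mul_sub_of_deriv_le (f := v)
      (fun y hy => (h1 y (hc y hy)).continuousAt.continuousWithinAt)
      (fun y hy => (h1 y (hc y (interior_subset hy))).differentiableAt.differentiableWithinAt)
      (C := v'' p) (fun y hy => by
        have hy' : p + 1 ≤ y := interior_subset hy
        rw [(h1 y (hc y hy')).deriv]
        have := hle y (by linarith)
        nlinarith) (p + 1) (Set.mem_Ici.2 le_rfl) t ht ht
    linarith
  have hv0 := hv (p + 1) (by linarith [show c < p from hp])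
  have hpos : 0 ≤ (v (p + 1) + 1) / (- v'' p) := div_nonneg (by linarith) (by linarith)
  have h3 := hle' (p + 1 + (v (p + 1) + 1) / (- v'' p)) (by linarith)
  have h4 := hv (p + 1 + (v (p + 1) + 1) / (- v'' p)) (by linarith [show c < p from hp])
  have h5 : v'' p * ((v (p + 1) + 1) / (- v'' p)) = -(v (p + 1) + 1) := by
    rw [div_neg, mul_neg, mul_div_cancel₀ _ hneg.ne]
  rw [add_sub_cancel_left, h5] at h3
  linarith

lemma ContDiff.hasDerivAt_iteratedDeriv {u : ℝ → ℝ} (hu : ContDiff ℝ (⊤ : ℕ∞) u) (k : ℕ) (y : ℝ) :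
    HasDerivAt (iteratedDeriv k u) (iteratedDeriv (k + 1) u y) y := by
  rw [iteratedDeriv_succ]
  exact ((hu.differentiable_iteratedDeriv k (by exact_mod_cast WithTop.coe_lt_top _)) y).hasDerivAt

lemma antitoneOn_iteratedDeriv {u : ℝ → ℝ} (hu : ContDiff ℝ (⊤ : ℕ∞) u) {c : ℝ} {k : ℕ}
    (h : ∀ y > c, iteratedDeriv (k + 1) u y ≤ 0) : AntitoneOn (iteratedDeriv k u) (Set.Ioi c) :=
  antitoneOn_of_deriv_nonpos (convex_Ioi c)
    (fun y _ => (hu.hasDerivAt_iteratedDeriv k y).continuousAt.continuousWithinAt)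
    (fun y _ => (hu.hasDerivAt_iteratedDeriv k y).differentiableAt.differentiableWithinAt)
    (fun y hy => by
      rw [(hu.hasDerivAt_iteratedDeriv k y).deriv]
      exact h y (interior_subset hy))

lemma iteratedDeriv_even_nonneg {u : ℝ → ℝ} (hu : ContDiff ℝ (⊤ : ℕ∞) u) {c : ℝ}
    (h2 : ∀ y > c, 0 ≤ iteratedDeriv 2 u y)
    (hodd : ∀ K : ℕ, ∀ y > c, iteratedDeriv (2 * K + 3) u y ≤ 0) (m : ℕ) :
    ∀ y > c, 0 ≤ iteratedDeriv (2 * m + 2) u y := by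
  induction m with
  | zero => exact h2
  | succ m ih =>
    exact nonneg_of_deriv_nonpos_of_antitone
      (fun y _ => hu.hasDerivAt_iteratedDeriv (2 * m + 2) y)
      (fun y _ => hu.hasDerivAt_iteratedDeriv (2 * m + 3) y) ih (hodd m)
      (antitoneOn_iteratedDeriv hu (hodd (m + 1)))

open MeasureTheory Convolution ContinuousLinearMap in
lemma Subentropic.iteratedDeriv_convolution {f : ℝ → ℝ} (hf : Subentropic f) {F : ℝ → ℝ} {a : ℝ}
    (ha : 0 < a) (hF : Continuous F) (hFf : ∀ y > a, F y = f y) (φ : ContDiffBump (0 : ℝ)) (m : ℕ) :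
    ∀ y > a + φ.rOut,
      0 ≤ iteratedDeriv (2 * m + 2) (φ.normed volume ⋆[lsmul ℝ ℝ, volume] F) y ∧
      iteratedDeriv (2 * m + 3) (φ.normed volume ⋆[lsmul ℝ ℝ, volume] F) y ≤ 0 := by
  have hodd : ∀ K : ℕ, ∀ y > a + φ.rOut,
      iteratedDeriv (2 * K + 3) (φ.normed volume ⋆[lsmul ℝ ℝ, volume] F) y ≤ 0 := by
    intro K y hy
    obtain ⟨w, x, hw, hneg, hfun⟩ := exists_difference_functional K
    have := mul_iteratedDeriv_convolution_nonneg hw ha hF hFf (hfun f hf) φ hy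
    by_contra! hc
    nlinarith
  have h2 : ∀ y > a + φ.rOut,
      0 ≤ iteratedDeriv 2 (φ.normed volume ⋆[lsmul ℝ ℝ, volume] F) y := by
    intro y hy
    have := mul_iteratedDeriv_convolution_nonneg secondDiff_moment ha hF hFf (fun t ε _ h => by
      rw [sum_secondDiff]
      have h0 := h 0
      have h1 := h 1
      simp only [Matrix.cons_val_zero, Matrix.cons_val_one, mul_one, mul_neg] at h0 h1
      exact (hf 0).1.secondDiff_nonneg h0 (by simpa [sub_eq_add_neg] using h1)) φ hy
    rw [secondDiff_moment_two] at this
    linarith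
  have hu : ContDiff ℝ (⊤ : ℕ∞) (φ.normed volume ⋆[lsmul ℝ ℝ, volume] F) :=
    φ.hasCompactSupport_normed.contDiff_convolution_left _ φ.contDiff_normed
      hF.locallyIntegrable
  exact fun y hy => ⟨iteratedDeriv_even_nonneg hu h2 hodd m y hy, hodd m y hy⟩

lemma ContDiff.exists_taylor_lagrange {u : ℝ → ℝ} (hu : ContDiff ℝ (⊤ : ℕ∞) u) (n : ℕ) (x h : ℝ) :
    ∃ ξ ∈ Set.uIcc x (x + h), u (x + h) =
      ∑ k ∈ Finset.range (n + 1), iteratedDeriv k u x / k.factorial * h ^ k +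
        iteratedDeriv (n + 1) u ξ * h ^ (n + 1) / (n + 1).factorial := by
  by_cases hh : h = 0
  · refine ⟨x, Set.left_mem_uIcc, ?_⟩
    subst hh
    rw [Finset.sum_eq_single 0 (fun k _ hk => by simp [hk]) (by simp)]
    simp
  · have hx : x ≠ x + h := by simpa [eq_comm] using hh
    obtain ⟨ξ, hξ, h1⟩ := taylor_mean_remainder_lagrange_iteratedDeriv (n := n) hx
      ((hu.of_le (by exact_mod_cast le_top)).contDiffOn (s := Set.uIcc x (x + h)))
    refine ⟨ξ, Set.Ioo_subset_Icc_self hξ, ?_⟩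
    rw [sub_eq_iff_eq_add', taylor_within_apply, add_sub_cancel_left] at h1
    rw [h1]
    congr 1
    refine Finset.sum_congr rfl fun k _ => ?_
    rw [iteratedDerivWithin_eq_iteratedDeriv (uniqueDiffOn_uIcc hx)
      (hu.of_le (by exact_mod_cast le_top)).contDiffAt Set.left_mem_uIcc, smul_eq_mul]
    ring

section AlternatingDerivatives

variable {u : ℝ → ℝ} {c : ℝ}

lemma iteratedDeriv_mul_pow_div_factorial_le (hu : ContDiff ℝ (⊤ : ℕ∞) u)
    (hs : ∀ k ≥ 2, ∀ y > c, 0 ≤ (-1) ^ k * iteratedDeriv k u y) {b ρ : ℝ} (hρ : 0 < ρ)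
    (hb : c < b - ρ) {k : ℕ} (hk : 2 ≤ k) :
    (-1) ^ k * iteratedDeriv k u b * ρ ^ k / k.factorial ≤ u (b - ρ) + u (b + ρ) - 2 * u b := by
  have hbc : c < b := by linarith
  obtain ⟨ξ, hξ, h1⟩ := hu.exists_taylor_lagrange k b (-ρ)
  obtain ⟨η, hη, h2⟩ := hu.exists_taylor_lagrange 1 b ρ
  have hξc : c < ξ := by
    rw [Set.uIcc_of_ge (by linarith)] at hξ
    linarith [hξ.1]
  have hηc : c < η := by
    rw [Set.uIcc_of_le (by linarith)] at hη
    linarith [hη.1]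
  have hr : ∀ j : ℕ, ∀ y : ℝ, iteratedDeriv j u y * (-ρ) ^ j / j.factorial =
      (-1) ^ j * iteratedDeriv j u y * ρ ^ j / j.factorial := by
    intro j y
    rw [neg_pow]
    ring
  have hnn : ∀ j ≥ 2, ∀ y > c, 0 ≤ iteratedDeriv j u y * (-ρ) ^ j / j.factorial := by
    intro j hj y hy
    rw [hr]
    have := hs j hj y hy
    positivity
  have hsum : ∑ j ∈ ({0, 1, k} : Finset ℕ), iteratedDeriv j u b / j.factorial * (-ρ) ^ j ≤
      ∑ j ∈ Finset.range (k + 1), iteratedDeriv j u b / j.factorial * (-ρ) ^ j := by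
    refine Finset.sum_le_sum_of_subset_of_nonneg ?_ ?_
    · intro j hj
      simp only [Finset.mem_insert, Finset.mem_singleton] at hj
      rw [Finset.mem_range]
      omega
    · intro j _ hj
      simp only [Finset.mem_insert, Finset.mem_singleton, not_or] at hj
      rw [div_mul_eq_mul_div]
      exact hnn j (by omega) b hbc
  rw [Finset.sum_insert (by simp; omega), Finset.sum_insert (by simp; omega),
    Finset.sum_singleton, div_mul_eq_mul_div _ _ ((-ρ) ^ k), hr] at hsum
  have h3 := hnn (k + 1) (by omega) ξ hξc
  have h4 := hs 2 le_rfl η hηc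
  have h5 : 0 ≤ iteratedDeriv 2 u η * ρ ^ 2 / 2 := by
    rw [neg_one_sq, one_mul] at h4
    positivity
  simp only [Finset.sum_range_succ, Finset.sum_range_zero] at h2
  norm_num [Nat.factorial, ← sub_eq_add_neg] at h1 h2 h3 hsum
  linarith

lemma abs_sub_taylor_le (hu : ContDiff ℝ (⊤ : ℕ∞) u)
    (hs : ∀ k ≥ 2, ∀ y > c, 0 ≤ (-1) ^ k * iteratedDeriv k u y) {x ρ h : ℝ} (hρ : 0 < ρ)
    (hx : c < x - 2 * ρ) (hh : |h| ≤ ρ) {n : ℕ} (hn : 1 ≤ n) :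
    |u (x + h) - ∑ k ∈ Finset.range (n + 1), iteratedDeriv k u x / k.factorial * h ^ k| ≤
      (u (x - 2 * ρ) + u x - 2 * u (x - ρ)) * (|h| / ρ) ^ (n + 1) := by
  obtain ⟨ξ, hξ, h1⟩ := hu.exists_taylor_lagrange n x h
  have hξ' : x - ρ ≤ ξ := by
    have := (abs_le.1 hh).1
    rcases Set.mem_uIcc.1 hξ with h2 | h2 <;> linarith [h2.1]
  have habs : ∀ y > c, |iteratedDeriv (n + 1) u y| = (-1) ^ (n + 1) * iteratedDeriv (n + 1) u y := by
    intro y hy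
    rw [← abs_of_nonneg (hs (n + 1) (by omega) y hy), abs_mul, abs_pow, abs_neg, abs_one, one_pow,
      one_mul]
  have hanti : AntitoneOn (fun y => (-1) ^ (n + 1) * iteratedDeriv (n + 1) u y) (Set.Ioi c) := by
    have hd := fun y => (hu.hasDerivAt_iteratedDeriv (n + 1) y).const_mul ((-1 : ℝ) ^ (n + 1))
    refine antitoneOn_of_deriv_nonpos (convex_Ioi c)
      (fun y _ => (hd y).continuousAt.continuousWithinAt)
      (fun y _ => (hd y).differentiableAt.differentiableWithinAt) fun y hy => ?_
    rw [(hd y).deriv]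
    have := hs (n + 2) (by omega) y (interior_subset hy)
    rw [pow_succ] at this
    linarith
  have hle := hanti (show x - ρ ∈ Set.Ioi c by simp; linarith)
    (show ξ ∈ Set.Ioi c by simp; linarith) hξ'
  have hM := iteratedDeriv_mul_pow_div_factorial_le hu hs (b := x - ρ) hρ (by linarith)
    (show 2 ≤ n + 1 by omega)
  rw [show x - ρ - ρ = x - 2 * ρ by ring, sub_add_cancel] at hM
  rw [h1, add_sub_cancel_left, abs_div, abs_mul, abs_pow, Nat.abs_cast, habs ξ (by linarith)]
  calc _ ≤ (-1) ^ (n + 1) * iteratedDeriv (n + 1) u (x - ρ) * |h| ^ (n + 1) /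
        (n + 1).factorial := by gcongr
    _ = (-1) ^ (n + 1) * iteratedDeriv (n + 1) u (x - ρ) * ρ ^ (n + 1) / (n + 1).factorial *
        (|h| / ρ) ^ (n + 1) := by
      rw [div_pow]
      field_simp
    _ ≤ _ := by gcongr

end AlternatingDerivatives

open Filter Topology in
lemma analyticAt_of_tendsto {u : ℕ → ℝ → ℝ} {a : ℕ → ℕ → ℝ} {f : ℝ → ℝ} {M : ℕ → ℝ} {L x ρ : ℝ}
    (hρ : 0 < ρ) (hM : Tendsto M atTop (𝓝 L))
    (hu : ∀ h, |h| ≤ ρ → Tendsto (fun n => u n (x + h)) atTop (𝓝 (f (x + h))))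
    (hT : ∀ᶠ n in atTop, ∀ N ≥ 1, ∀ h, |h| ≤ ρ →
      |u n (x + h) - ∑ k ∈ Finset.range (N + 1), a n k * h ^ k| ≤ M n * (|h| / ρ) ^ (N + 1)) :
    AnalyticAt ℝ f x := by
  have hM1 : ∀ᶠ n in atTop, M n ≤ L + 1 := hM.eventually_le_const (by linarith)
  have hu1 : ∀ᶠ n in atTop, |u n (x + ρ)| ≤ |f (x + ρ)| + 1 :=
    (hu ρ (abs_of_pos hρ).le).abs.eventually_le_const (by linarith)
  have hu2 : ∀ᶠ n in atTop, |u n (x + 0)| ≤ |f (x + 0)| + 1 :=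
    (hu 0 (by simpa using hρ.le)).abs.eventually_le_const (by linarith)
  set C := 2 * (L + 1) + (|f (x + ρ)| + 1) + (|f (x + 0)| + 1) with hC
  have hbd : ∀ᶠ n in atTop, ∀ k, |a n k * ρ ^ k| ≤ C := by
    filter_upwards [hM1, hu1, hu2, hT] with n h1 h2 h3 h4 k
    have h5 : ∀ N ≥ 1, |u n (x + ρ) - ∑ k ∈ Finset.range (N + 1), a n k * ρ ^ k| ≤ L + 1 := by
      intro N hN
      refine (h4 N hN ρ (abs_of_pos hρ).le).trans ?_
      rwa [abs_of_pos hρ, div_self hρ.ne', one_pow, mul_one]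
    have hL : 0 ≤ L + 1 := (abs_nonneg _).trans (h5 1 le_rfl)
    have h0 : |a n 0| ≤ |f (x + 0)| + 1 := by
      have := h4 1 le_rfl 0 (by simpa using hρ.le)
      simp only [Finset.sum_range_succ, Finset.sum_range_zero] at this
      norm_num at this
      rw [add_zero] at h3
      rw [show a n 0 = u n x by linarith]
      simpa using h3
    have hsum : ∀ N, |u n (x + ρ) - ∑ k ∈ Finset.range (N + 1), a n k * ρ ^ k| ≤
        (L + 1) + (|f (x + ρ)| + 1) + (|f (x + 0)| + 1) := by
      intro N
      rcases Nat.eq_zero_or_pos N with rfl | hN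
      · simp only [zero_add, Finset.sum_range_one, pow_zero, mul_one]
        have := abs_sub (u n (x + ρ)) (a n 0)
        linarith
      · have := h5 N hN
        have := abs_nonneg (f (x + ρ))
        have := abs_nonneg (f (x + 0))
        linarith
    rcases k with _ | k
    · simp only [pow_zero, mul_one]
      have := abs_nonneg (f (x + ρ))
      linarith
    · have e : a n (k + 1) * ρ ^ (k + 1) =
          (u n (x + ρ) - ∑ k ∈ Finset.range (k + 1), a n k * ρ ^ k) -
          (u n (x + ρ) - ∑ k ∈ Finset.range (k + 1 + 1), a n k * ρ ^ k) := by
        rw [Finset.sum_range_succ _ (k + 1)]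
        ring
      rw [e]
      have := abs_sub (u n (x + ρ) - ∑ k ∈ Finset.range (k + 1), a n k * ρ ^ k)
        (u n (x + ρ) - ∑ k ∈ Finset.range (k + 1 + 1), a n k * ρ ^ k)
      have := hsum k
      have := h5 (k + 1) (by omega)
      linarith
  set U : Ultrafilter ℕ := hyperfilter ℕ
  have hU : (U : Filter ℕ) ≤ atTop := Nat.hyperfilter_le_atTop
  have hlim : ∀ k, ∃ α : ℝ, Tendsto (fun n => a n k) U (𝓝 α) := by
    intro k
    have hk : ∀ᶠ n in (U : Filter ℕ), a n k ∈ Set.Icc (-(C / ρ ^ k)) (C / ρ ^ k) := by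
      filter_upwards [hbd.filter_mono hU] with n hn
      rw [Set.mem_Icc, ← abs_le, le_div_iff₀ (pow_pos hρ k)]
      have := hn k
      rwa [abs_mul, abs_of_pos (pow_pos hρ k)] at this
    obtain ⟨α, -, hα⟩ := isCompact_Icc.ultrafilter_le_nhds (U.map fun n => a n k)
      (le_principal_iff.2 hk)
    exact ⟨α, hα⟩
  choose α hα using hlim
  have hbdα : ∀ k, |α k * ρ ^ k| ≤ C := fun k =>
    le_of_tendsto ((hα k).mul_const _).abs ((hbd.filter_mono hU).mono fun n hn => hn k)
  have hTα : ∀ N ≥ 1, ∀ h, |h| ≤ ρ →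
      |f (x + h) - ∑ k ∈ Finset.range (N + 1), α k * h ^ k| ≤ L * (|h| / ρ) ^ (N + 1) := by
    intro N hN h hh
    refine le_of_tendsto_of_tendsto
      (((hu h hh).mono_left hU).sub (tendsto_finsetSum _ fun k _ => (hα k).mul_const _)).abs
      ((hM.mono_left hU).mul_const _) ((hT.filter_mono hU).mono fun n hn => hn N hN h hh)
  refine ⟨FormalMultilinearSeries.ofScalars ℝ α, hasFPowerSeriesAt_iff.2 ?_⟩
  filter_upwards [Metric.ball_mem_nhds (0 : ℝ) hρ] with h hh
  rw [mem_ball_zero_iff, Real.norm_eq_abs] at hh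
  have hq : |h| / ρ < 1 := (div_lt_one hρ).2 hh
  have hq0 : 0 ≤ |h| / ρ := by positivity
  have hsm : Summable fun k => α k * h ^ k := by
    refine Summable.of_norm_bounded ((summable_geometric_of_lt_one hq0 hq).mul_left C) fun k => ?_
    have : ‖α k * h ^ k‖ = |α k * ρ ^ k| * (|h| / ρ) ^ k := by
      rw [Real.norm_eq_abs, abs_mul, abs_mul, abs_pow, abs_pow, abs_of_pos hρ, div_pow]
      field_simp
    rw [this]
    gcongr
    exact hbdα k
  have hpart : Tendsto (fun N => ∑ k ∈ Finset.range (N + 1), α k * h ^ k) atTop (𝓝 (f (x + h))) := by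
    rw [tendsto_iff_norm_sub_tendsto_zero]
    refine squeeze_zero' (Eventually.of_forall fun _ => norm_nonneg _) ?_
      (g := fun N => L * (|h| / ρ) ^ (N + 1)) ?_
    · filter_upwards [eventually_ge_atTop 1] with N hN
      rw [norm_sub_rev]
      exact hTα N hN h hh.le
    · have := ((tendsto_pow_atTop_nhds_zero_of_lt_one hq0 hq).comp (tendsto_add_atTop_nat 1)).const_mul L
      simpa using this
  have hS := hsm.hasSum
  rw [tendsto_nhds_unique ((tendsto_add_atTop_iff_nat 1).2 hS.tendsto_sum_nat) hpart] at hS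
  simpa [FormalMultilinearSeries.coeff_ofScalars, mul_comm] using hS

open Filter Topology MeasureTheory Convolution ContinuousLinearMap in
lemma Subentropic.analyticAt {f : ℝ → ℝ} (hf : Subentropic f) {x : ℝ} (hx : 0 < x) :
    AnalyticAt ℝ f x := by
  have ha : 0 < x / 8 := by positivity
  set F : ℝ → ℝ := fun y => f (max y (x / 8)) with hFdef
  have hF : Continuous F := hf.continuousOn.comp_continuous
    (continuous_id.max continuous_const) fun y => lt_max_of_lt_right ha
  have hFf : ∀ y > x / 8, F y = f y := fun y hy => by rw [hFdef]; simp only [max_eq_left hy.le]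
  have hδ : ∀ n : ℕ, 0 < x / 8 / (n + 1) := fun n => by positivity
  let φ : ℕ → ContDiffBump (0 : ℝ) := fun n =>
    ⟨x / 8 / (n + 1) / 2, x / 8 / (n + 1), half_pos (hδ n), half_lt_self (hδ n)⟩
  have hφ : Tendsto (fun n => (φ n).rOut) atTop (𝓝 0) := by
    have := (tendsto_one_div_add_atTop_nhds_zero_nat (𝕜 := ℝ)).const_mul (x / 8)
    rw [mul_zero] at this
    exact this.congr fun n => by simp only [φ]; ring
  have hφle : ∀ n, (φ n).rOut ≤ x / 8 := fun n =>
    div_le_self ha.le (by have := Nat.cast_nonneg (α := ℝ) n; linarith)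
  set u : ℕ → ℝ → ℝ := fun n => (φ n).normed volume ⋆[lsmul ℝ ℝ, volume] F with hu
  have hlim : ∀ y, Tendsto (fun n => u n y) atTop (𝓝 (F y)) := fun y =>
    ContDiffBump.convolution_tendsto_right_of_continuous hφ hF y
  have hsm : ∀ n, ContDiff ℝ (⊤ : ℕ∞) (u n) := fun n =>
    (φ n).hasCompactSupport_normed.contDiff_convolution_left _ (φ n).contDiff_normed
      hF.locallyIntegrable
  have hsign : ∀ n, ∀ k ≥ 2, ∀ y > x / 8 + (φ n).rOut,
      0 ≤ (-1) ^ k * iteratedDeriv k (u n) y := by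
    intro n k hk y hy
    obtain ⟨m, rfl | rfl⟩ : ∃ m, k = 2 * m + 2 ∨ k = 2 * m + 3 := ⟨(k - 2) / 2, by omega⟩
    · rw [Even.neg_one_pow ⟨m + 1, by ring⟩, one_mul]
      exact (hf.iteratedDeriv_convolution ha hF hFf (φ n) m y hy).1
    · rw [Odd.neg_one_pow ⟨m + 1, by ring⟩, neg_one_mul]
      exact neg_nonneg.2 (hf.iteratedDeriv_convolution ha hF hFf (φ n) m y hy).2
  refine analyticAt_of_tendsto (u := u) (ρ := x / 4) (by positivity)
    (((hlim (x - 2 * (x / 4))).add (hlim x)).sub ((hlim (x - x / 4)).const_mul 2))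
    (a := fun n k => iteratedDeriv k (u n) x / k.factorial) (fun h hh => ?_)
    (Eventually.of_forall fun n N hN h hh => ?_)
  · rw [← hFf (x + h) (by linarith [(abs_le.1 hh).1])]
    exact hlim _
  · exact abs_sub_taylor_le (hsm n) (hsign n) (by positivity) (by linarith [hφle n]) hh hN

lemma Subentropic.scalar_ineq {f : ℝ → ℝ} (hf : Subentropic f) {t s p q : ℝ} (h1 : 0 < t + p)
    (h2 : 0 < t - p) (h3 : 0 < s + q) (h4 : 0 < s - q) :
    f (t + s + (p + q)) + f (t + s - (p + q)) - 2 * f (t + s) ≤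
      (f (t + p) + f (t - p) - 2 * f t) + (f (s + q) + f (s - q) - 2 * f s) := by
  set D : ℝ → Matrix (Fin 1) (Fin 1) ℂ := fun r => Matrix.diagonal fun _ => (r : ℂ) with hD
  have htr : ∀ r, trFn f (D r) = f r := fun r => by
    have := trFn_conjStarAlgAut_diagonal f 1 (fun _ : Fin 1 => r) (A := D r) (by simp [hD])
    simpa using this
  have hpos : ∀ {r}, 0 < r → (D r).PosDef := fun {r} hr => by
    rw [hD, Matrix.posDef_diagonal_iff]
    exact fun _ => by exact_mod_cast hr
  have hadd : ∀ r r', D r + D r' = D (r + r') := fun r r' => by simp [hD]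
  have hmid : ∀ r r', (1 / 2 : ℝ) • D (r + r') + (1 / 2 : ℝ) • D (r - r') = D r := fun r r' => by
    ext i j
    simp only [hD, Matrix.add_apply, Matrix.smul_apply, Matrix.diagonal_apply,
      Subsingleton.elim i j, if_true, Complex.real_smul]
    push_cast
    ring
  have hconv := ((hf 2).2 1).2
    (show ∀ i, ((![D (t + p), D (s + q)] : Fin 2 → _) i).PosDef from
      Fin.forall_fin_two.2 ⟨hpos h1, hpos h3⟩)
    (show ∀ i, ((![D (t - p), D (s - q)] : Fin 2 → _) i).PosDef from
      Fin.forall_fin_two.2 ⟨hpos h2, hpos h4⟩)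
    (by norm_num : (0 : ℝ) ≤ 1 / 2) (by norm_num : (0 : ℝ) ≤ 1 / 2) (by norm_num)
  simp only [Fin.sum_univ_two, Pi.add_apply, Pi.smul_apply, Matrix.cons_val_zero,
    Matrix.cons_val_one, hmid, hadd, htr, smul_eq_mul] at hconv
  rw [show t + p + (s + q) = t + s + (p + q) by ring,
    show t - p + (s - q) = t + s - (p + q) by ring] at hconv
  linarith

open Filter Topology in
lemma tendsto_secondDiff_div_sq {f : ℝ → ℝ} (hf : ∀ t > 0, AnalyticAt ℝ f t) {t : ℝ}
    (ht : 0 < t) (p : ℝ) :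
    Tendsto (fun ε => (f (t + ε * p) + f (t - ε * p) - 2 * f t) / ε ^ 2) (𝓝[>] 0)
      (𝓝 (p ^ 2 * deriv (deriv f) t)) := by
  have hw : ∀ k < 2, ∑ i, (![1, 1, -2] : Fin 3 → ℝ) i * (![p, -p, 0] : Fin 3 → ℝ) i ^ k = 0 := by
    intro k hk
    interval_cases k <;> simp [Fin.sum_univ_three]
    norm_num
  have h := tendsto_sum_div_pow hw isOpen_Ioi (convex_Ioi 0)
    (fun y hy => (hf y hy).contDiffAt.contDiffWithinAt) ht
  have e : ((Nat.factorial 2 : ℕ) : ℝ)⁻¹ * ((∑ i, (![1, 1, -2] : Fin 3 → ℝ) i *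
      (![p, -p, 0] : Fin 3 → ℝ) i ^ 2) * iteratedDeriv 2 f t) = p ^ 2 * deriv (deriv f) t := by
    rw [iteratedDeriv_succ, iteratedDeriv_one]
    simp [Fin.sum_univ_three, Nat.factorial]
    ring
  rw [e] at h
  refine h.congr fun ε => ?_
  simp [Fin.sum_univ_three, sub_eq_add_neg]

open Filter Topology in
lemma Subentropic.sq_mul_deriv_deriv_le {f : ℝ → ℝ} (hf : Subentropic f) {t s : ℝ} (ht : 0 < t)
    (hs : 0 < s) (p q : ℝ) :
    (p + q) ^ 2 * deriv (deriv f) (t + s) ≤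
      p ^ 2 * deriv (deriv f) t + q ^ 2 * deriv (deriv f) s := by
  have hA : ∀ y > 0, AnalyticAt ℝ f y := fun y hy => hf.analyticAt hy
  have hpos : ∀ {a : ℝ} (b : ℝ), 0 < a → ∀ᶠ ε in 𝓝[>] (0 : ℝ), 0 < a + ε * b := by
    intro a b ha
    have : Continuous fun ε : ℝ => a + ε * b := by fun_prop
    exact ((this.tendsto' 0 a (by simp)).mono_left nhdsWithin_le_nhds).eventually_const_lt ha
  refine le_of_tendsto_of_tendsto (tendsto_secondDiff_div_sq hA (add_pos ht hs) (p + q))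
    ((tendsto_secondDiff_div_sq hA ht p).add (tendsto_secondDiff_div_sq hA hs q)) ?_
  filter_upwards [hpos p ht, hpos (-p) ht, hpos q hs, hpos (-q) hs] with ε h1 h2 h3 h4
  rw [← add_div, mul_add]
  gcongr
  exact hf.scalar_ineq h1 (by linarith) h3 (by linarith)

lemma deriv_deriv_nonneg_of_convexOn {f : ℝ → ℝ} (hf : ConvexOn ℝ (Set.Ioi 0) f)
    (hA : ∀ t > 0, AnalyticAt ℝ f t) {t : ℝ} (ht : 0 < t) : 0 ≤ deriv (deriv f) t := by
  have hm : MonotoneOn (deriv f) (Set.Ioi 0) :=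
    hf.monotoneOn_deriv fun y hy => (hA y hy).differentiableAt
  rw [← derivWithin_of_isOpen isOpen_Ioi ht]
  exact hm.derivWithin_nonneg

lemma exists_affine_of_deriv_deriv_eq_zero {f : ℝ → ℝ} (hA : ∀ t > 0, AnalyticAt ℝ f t)
    (h : ∀ t > 0, deriv (deriv f) t = 0) : ∃ a b : ℝ, ∀ t > (0 : ℝ), f t = a * t + b := by
  have h1 : ∀ t > 0, deriv f t = deriv f 1 := fun t ht =>
    isOpen_Ioi.is_const_of_deriv_eq_zero isPreconnected_Ioi
      (fun y hy => (hA y hy).deriv.differentiableAt.differentiableWithinAt) (fun y hy => h y hy)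
      ht (Set.mem_Ioi.2 one_pos)
  have hd : ∀ t > 0, HasDerivAt (fun y => f y - deriv f 1 * y) 0 t := fun t ht => by
    have := (hA t ht).differentiableAt.hasDerivAt.sub ((hasDerivAt_id t).const_mul (deriv f 1))
    rw [h1 t ht, mul_one, sub_self] at this
    exact this
  refine ⟨deriv f 1, f 1 - deriv f 1 * 1, fun t ht => ?_⟩
  have := isOpen_Ioi.is_const_of_deriv_eq_zero isPreconnected_Ioi
    (fun y hy => (hd y hy).differentiableAt.differentiableWithinAt) (fun y hy => (hd y hy).deriv)
    (Set.mem_Ioi.2 ht) (Set.mem_Ioi.2 one_pos)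
  linarith

lemma Subentropic.deriv_deriv_pos {f : ℝ → ℝ} (hf : Subentropic f)
    (hna : ¬ ∃ a b : ℝ, ∀ t > (0 : ℝ), f t = a * t + b) {t : ℝ} (ht : 0 < t) :
    0 < deriv (deriv f) t := by
  have hA : ∀ y > 0, AnalyticAt ℝ f y := fun y hy => hf.analyticAt hy
  have hnn := fun {y : ℝ} (hy : 0 < y) => deriv_deriv_nonneg_of_convexOn (hf 0).1 hA hy
  refine (hnn ht).lt_of_ne fun h0 => hna (exists_affine_of_deriv_deriv_eq_zero hA ?_)
  have hzero : ∀ y > t, deriv (deriv f) y = 0 := by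
    intro y hy
    have := hf.sq_mul_deriv_deriv_le ht (sub_pos.2 hy) 1 0
    rw [add_sub_cancel, ← h0] at this
    exact le_antisymm (by linarith) (hnn (ht.trans hy))
  have hon : AnalyticOnNhd ℝ (deriv (deriv f)) (Set.Ioi 0) := fun y hy => (hA y hy).deriv.deriv
  refine hon.eqOn_zero_of_preconnected_of_eventuallyEq_zero isPreconnected_Ioi
    (show t + 1 ∈ Set.Ioi 0 by simp; linarith) ?_
  filter_upwards [Ioi_mem_nhds (lt_add_one t)] with y hy
  exact hzero y hy

lemma one_div_add_one_div_le_of_sq_mul_le {A B C : ℝ} (hA : 0 < A) (hB : 0 < B) (hC : 0 < C)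
    (h : ∀ p q : ℝ, (p + q) ^ 2 * C ≤ p ^ 2 * A + q ^ 2 * B) : 1 / A + 1 / B ≤ 1 / C := by
  have h1 := h (1 / A) (1 / B)
  have e : (1 / A) ^ 2 * A + (1 / B) ^ 2 * B = 1 / A + 1 / B := by field_simp
  have hpos : 0 < 1 / A + 1 / B := by positivity
  rw [e] at h1
  rw [le_div_iff₀ hC]
  nlinarith

/-- For a non-affine subentropic function `f`, the function
`g(t) = 1/f''(t)` is positive, infinitely differentiable and super-additive on `(0,∞)`. -/
theorem subentropic_reciprocal_second_deriv_superadditive (f : ℝ → ℝ)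
    (hf : Subentropic f) (hna : ¬ ∃ a b : ℝ, ∀ t > (0 : ℝ), f t = a * t + b) :
    (∀ t > (0 : ℝ), 0 < 1 / deriv (deriv f) t) ∧
    ContDiffOn ℝ (⊤ : ℕ∞) (fun t => 1 / deriv (deriv f) t) (Set.Ioi 0) ∧
    (∀ t > (0 : ℝ), ∀ s > (0 : ℝ),
      1 / deriv (deriv f) t + 1 / deriv (deriv f) s ≤ 1 / deriv (deriv f) (t + s)) := by
  have hpos : ∀ t > 0, 0 < deriv (deriv f) t := fun t ht => hf.deriv_deriv_pos hna ht
  refine ⟨fun t ht => one_div_pos.2 (hpos t ht), fun t ht => ?_, fun t ht s hs => ?_⟩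
  · exact (contDiffAt_const.div (hf.analyticAt ht).deriv.deriv.contDiffAt
      (hpos t ht).ne').contDiffWithinAt
  · exact one_div_add_one_div_le_of_sq_mul_le (hpos t ht) (hpos s hs) (hpos _ (add_pos ht hs))
      (hf.sq_mul_deriv_deriv_le ht hs)

end
end

section
/- The function f(t) = t·log t is entropic: for every finite-dimensional bipartite Hilbert space H = H₁ ⊗ H₂, the map ρ ↦ −Tr(ρ₁ log ρ₁) + Tr(ρ log ρ) is convex in positive definite operators ρ on H, where ρ₁ denotes the partial trace of ρ on H₁. Equivalently, the conditional entropy S(ρ) − S(ρ₁) is concave in ρ, where S is the von Neumann entropy. -/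
open scoped Matrix
open Matrix
open scoped ComplexOrder

noncomputable section

/-- A real-linear functional of the pair `(A, B)`; its supremum over `Z` is the quadratic form
`⟨A - B, ((1 - t) L_A + t R_B)⁻¹ (A - B)⟩`, where `L_A` and `R_B` denote left and right
multiplication. -/
def quadFunctional {d : Type*} [Fintype d] (t : ℝ) (Z A B : Matrix d d ℂ) : ℝ :=
  2 * (trace (Zᴴ * (A - B))).re - (1 - t) * (trace (Zᴴ * A * Z)).re
    - t * (trace (Z * B * Zᴴ)).re

theorem quadFunctional_combo {d : Type*} [Fintype d] (t : ℝ) (Z A B A' B' : Matrix d d ℂ)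
    (x y : ℝ) :
    quadFunctional t Z (x • A + y • A') (x • B + y • B') =
      x * quadFunctional t Z A B + y * quadFunctional t Z A' B' := by
  simp only [quadFunctional, mul_add, add_mul, mul_sub, mul_smul_comm, smul_mul_assoc, trace_add,
    trace_sub, trace_smul, Complex.add_re, Complex.sub_re, Complex.smul_re, smul_eq_mul]
  ring

/-- The supremum over `Z` of `quadFunctional t Z A B`, for `A = U diag(a) Uᴴ` and
`B = V diag(b) Vᴴ`. -/
def quadForm {d : Type*} [Fintype d] (t : ℝ) (U : Matrix d d ℂ) (a : d → ℝ) (V : Matrix d d ℂ)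
    (b : d → ℝ) : ℝ :=
  ∑ p, ∑ q, Complex.normSq ((Uᴴ * V) p q) * ((a p - b q) ^ 2 / ((1 - t) * a p + t * b q))

section

variable {d : Type*} [Fintype d] [DecidableEq d]

theorem trace_conjTranspose_mul_diagonal_mul_re (Y : Matrix d d ℂ) (a : d → ℝ) :
    (trace (Yᴴ * diagonal (fun i => (a i : ℂ)) * Y)).re =
      ∑ p, ∑ q, a p * Complex.normSq (Y p q) := by
  rw [trace, Complex.re_sum, Finset.sum_comm]
  refine Finset.sum_congr rfl fun q _ => ?_
  rw [diag_apply, mul_apply, Complex.re_sum]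
  refine Finset.sum_congr rfl fun p _ => ?_
  simp [mul_diagonal, Complex.normSq_apply]
  ring

theorem trace_mul_diagonal_mul_conjTranspose_re (Y : Matrix d d ℂ) (b : d → ℝ) :
    (trace (Y * diagonal (fun i => (b i : ℂ)) * Yᴴ)).re =
      ∑ p, ∑ q, b q * Complex.normSq (Y p q) := by
  rw [trace, Complex.re_sum]
  refine Finset.sum_congr rfl fun q _ => ?_
  rw [diag_apply, mul_apply, Complex.re_sum]
  refine Finset.sum_congr rfl fun p _ => ?_
  simp [mul_diagonal, Complex.normSq_apply]
  ring

theorem trace_conjTranspose_mul_sub_re (Y W : Matrix d d ℂ) (a b : d → ℝ) :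
    (trace (Yᴴ * (diagonal (fun i => (a i : ℂ)) * W - W * diagonal (fun i => (b i : ℂ))))).re =
      ∑ p, ∑ q, (a p - b q) * (star (Y p q) * W p q).re := by
  rw [trace, Complex.re_sum, Finset.sum_comm]
  refine Finset.sum_congr rfl fun q _ => ?_
  rw [diag_apply, mul_apply, Complex.re_sum]
  refine Finset.sum_congr rfl fun p _ => ?_
  simp [mul_diagonal]
  ring

theorem quadFunctional_spectral {U V : Matrix d d ℂ} (hU : Uᴴ * U = 1) (hV : Vᴴ * V = 1)
    (t : ℝ) (Y : Matrix d d ℂ) (a b : d → ℝ) :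
    quadFunctional t (U * Y * Vᴴ) (U * diagonal (fun i => (a i : ℂ)) * Uᴴ)
        (V * diagonal (fun i => (b i : ℂ)) * Vᴴ) =
      ∑ p, ∑ q, (2 * ((a p - b q) * (star (Y p q) * (Uᴴ * V) p q).re)
        - ((1 - t) * a p + t * b q) * Complex.normSq (Y p q)) := by
  set Da := diagonal (fun i => (a i : ℂ)) with hDa
  set Db := diagonal (fun i => (b i : ℂ)) with hDb
  have h1 : trace ((U * Y * Vᴴ)ᴴ * (U * Da * Uᴴ - V * Db * Vᴴ)) =
      trace (Yᴴ * (Da * (Uᴴ * V) - (Uᴴ * V) * Db)) := by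
    have : (U * Y * Vᴴ)ᴴ * (U * Da * Uᴴ - V * Db * Vᴴ) =
        V * (Yᴴ * ((Uᴴ * U) * Da * Uᴴ - Uᴴ * V * Db * Vᴴ)) := by
      simp only [conjTranspose_mul, conjTranspose_conjTranspose, mul_sub, Matrix.mul_assoc]
    rw [this, trace_mul_comm, hU, Matrix.mul_assoc Yᴴ, sub_mul, Matrix.mul_assoc _ Vᴴ V, hV]
    simp only [Matrix.mul_assoc, Matrix.one_mul, Matrix.mul_one]
  have h2 : trace ((U * Y * Vᴴ)ᴴ * (U * Da * Uᴴ) * (U * Y * Vᴴ)) = trace (Yᴴ * Da * Y) := by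
    have : (U * Y * Vᴴ)ᴴ * (U * Da * Uᴴ) * (U * Y * Vᴴ) =
        V * (Yᴴ * (Uᴴ * U) * Da * (Uᴴ * U) * Y * Vᴴ) := by
      simp only [conjTranspose_mul, conjTranspose_conjTranspose, Matrix.mul_assoc]
    rw [this, trace_mul_comm, hU, Matrix.mul_assoc _ Vᴴ V, hV]
    simp only [Matrix.mul_one]
  have h3 : trace ((U * Y * Vᴴ) * (V * Db * Vᴴ) * (U * Y * Vᴴ)ᴴ) = trace (Y * Db * Yᴴ) := by
    have : (U * Y * Vᴴ) * (V * Db * Vᴴ) * (U * Y * Vᴴ)ᴴ =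
        U * (Y * (Vᴴ * V) * Db * (Vᴴ * V) * Yᴴ * Uᴴ) := by
      simp only [conjTranspose_mul, conjTranspose_conjTranspose, Matrix.mul_assoc]
    rw [this, trace_mul_comm, hV, Matrix.mul_assoc _ Uᴴ U, hU]
    simp only [Matrix.mul_one]
  rw [quadFunctional, h1, h2, h3, hDa, hDb, trace_conjTranspose_mul_sub_re,
    trace_conjTranspose_mul_diagonal_mul_re, trace_mul_diagonal_mul_conjTranspose_re]
  simp only [Finset.mul_sum, ← Finset.sum_sub_distrib]
  refine Finset.sum_congr rfl fun p _ => Finset.sum_congr rfl fun q _ => ?_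
  ring

theorem quadFunctional_le_quadForm {U V : Matrix d d ℂ} (hU : Uᴴ * U = 1) (hV : Vᴴ * V = 1)
    {t : ℝ} {a b : d → ℝ} (hc : ∀ p q, 0 < (1 - t) * a p + t * b q) (Z : Matrix d d ℂ) :
    quadFunctional t Z (U * diagonal (fun i => (a i : ℂ)) * Uᴴ)
      (V * diagonal (fun i => (b i : ℂ)) * Vᴴ) ≤ quadForm t U a V b := by
  have hZ : Z = U * (Uᴴ * Z * V) * Vᴴ := by
    have : U * (Uᴴ * Z * V) * Vᴴ = (U * Uᴴ) * Z * (V * Vᴴ) := by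
      simp only [Matrix.mul_assoc]
    rw [this, mul_eq_one_comm.mp hU, mul_eq_one_comm.mp hV, Matrix.one_mul, Matrix.mul_one]
  rw [hZ, quadFunctional_spectral hU hV, quadForm]
  refine Finset.sum_le_sum fun p _ => Finset.sum_le_sum fun q _ => ?_
  have hpq := hc p q
  generalize (1 - t) * a p + t * b q = c at hpq ⊢
  generalize a p - b q = δ
  generalize (Uᴴ * Z * V) p q = y
  generalize (Uᴴ * V) p q = w
  rw [mul_div_assoc', le_div_iff₀ hpq]
  simp only [Complex.normSq_apply, Complex.mul_re, Complex.star_def, Complex.conj_re,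
    Complex.conj_im]
  nlinarith [sq_nonneg (δ * w.re - c * y.re), sq_nonneg (δ * w.im - c * y.im)]

theorem exists_quadFunctional_eq_quadForm {U V : Matrix d d ℂ} (hU : Uᴴ * U = 1)
    (hV : Vᴴ * V = 1) {t : ℝ} {a b : d → ℝ} (hc : ∀ p q, 0 < (1 - t) * a p + t * b q) :
    ∃ Z, quadFunctional t Z (U * diagonal (fun i => (a i : ℂ)) * Uᴴ)
      (V * diagonal (fun i => (b i : ℂ)) * Vᴴ) = quadForm t U a V b := by
  refine ⟨U * (of fun p q => (((a p - b q) / ((1 - t) * a p + t * b q) : ℝ) : ℂ) *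
    (Uᴴ * V) p q) * Vᴴ, ?_⟩
  rw [quadFunctional_spectral hU hV, quadForm]
  refine Finset.sum_congr rfl fun p _ => Finset.sum_congr rfl fun q _ => ?_
  have hpq := hc p q
  rw [of_apply]
  generalize (1 - t) * a p + t * b q = c at hpq ⊢
  generalize a p - b q = δ
  generalize (Uᴴ * V) p q = w
  simp only [Complex.normSq_apply, Complex.mul_re, Complex.mul_im, Complex.star_def,
    Complex.conj_re, Complex.conj_im, Complex.ofReal_re, Complex.ofReal_im]
  field_simp
  ring

end

theorem pos_lineMap {a b t : ℝ} (ha : 0 < a) (hb : 0 < b) (ht : t ∈ Set.Icc (0 : ℝ) 1) :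
    0 < (1 - t) * a + t * b := by
  rcases ht with ⟨h0, h1⟩
  rcases h0.eq_or_lt with rfl | h0
  · simpa using ha
  · have := mul_nonneg (sub_nonneg.2 h1) ha.le
    positivity

theorem continuousOn_mul_div_lineMap {a b : ℝ} (ha : 0 < a) (hb : 0 < b) :
    ContinuousOn (fun t : ℝ => t * ((a - b) ^ 2 / ((1 - t) * a + t * b)))
      (Set.uIcc (0 : ℝ) 1) := by
  rw [Set.uIcc_of_le zero_le_one]
  exact continuousOn_id.mul (continuousOn_const.div (by fun_prop)
    fun t ht => (pos_lineMap ha hb ht).ne')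

theorem integral_mul_div_lineMap {a b : ℝ} (ha : 0 < a) (hb : 0 < b) :
    ∫ t in (0 : ℝ)..1, t * ((a - b) ^ 2 / ((1 - t) * a + t * b)) =
      a * Real.log a - a * Real.log b - (a - b) := by
  rw [intervalIntegral.integral_eq_sub_of_hasDerivAt
    (f := fun t => -t * (a - b) - a * Real.log ((1 - t) * a + t * b)) _
    (continuousOn_mul_div_lineMap ha hb).intervalIntegrable]
  · simp
    ring
  · intro t ht
    rw [Set.uIcc_of_le zero_le_one] at ht
    have hc := (pos_lineMap ha hb ht).ne'
    have h1 : HasDerivAt (fun t : ℝ => (1 - t) * a + t * b) (-1 * a + 1 * b) t :=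
      (((hasDerivAt_id t).const_sub 1).mul_const a).add ((hasDerivAt_id t).mul_const b)
    have h2 := ((hasDerivAt_id t).neg.mul_const (a - b)).sub ((h1.log hc).const_mul a)
    refine (h2.congr_deriv ?_).congr_of_eventuallyEq (Filter.Eventually.of_forall fun _ => rfl)
    refine mul_right_cancel₀ hc ?_
    rw [sub_mul, mul_assoc t, div_mul_cancel₀ _ hc, mul_assoc a, div_mul_cancel₀ _ hc]
    ring

theorem intervalIntegrable_mul_quadForm {d : Type*} [Fintype d] (U V : Matrix d d ℂ) {a b : d → ℝ}
    (ha : ∀ p, 0 < a p) (hb : ∀ q, 0 < b q) :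
    IntervalIntegrable (fun t => t * quadForm t U a V b) MeasureTheory.volume 0 1 := by
  refine ContinuousOn.intervalIntegrable ?_
  simp only [quadForm, Finset.mul_sum]
  refine continuousOn_finsetSum _ fun p _ => continuousOn_finsetSum _ fun q _ => ?_
  simp only [mul_left_comm _ (Complex.normSq _)]
  exact continuousOn_const.mul (continuousOn_mul_div_lineMap (ha p) (hb q))

theorem integral_mul_quadForm {d : Type*} [Fintype d] (U V : Matrix d d ℂ) {a b : d → ℝ}
    (ha : ∀ p, 0 < a p) (hb : ∀ q, 0 < b q) :
    ∫ t in (0 : ℝ)..1, t * quadForm t U a V b =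
      ∑ p, ∑ q, Complex.normSq ((Uᴴ * V) p q) *
        (a p * Real.log (a p) - a p * Real.log (b q) - (a p - b q)) := by
  have h (p q : d) : IntervalIntegrable (fun t => Complex.normSq ((Uᴴ * V) p q) *
      (t * ((a p - b q) ^ 2 / ((1 - t) * a p + t * b q)))) MeasureTheory.volume 0 1 :=
    (continuousOn_const.mul (continuousOn_mul_div_lineMap (ha p) (hb q))).intervalIntegrable
  simp only [quadForm, Finset.mul_sum, mul_left_comm _ (Complex.normSq _)]
  rw [intervalIntegral.integral_finsetSum fun p _ => by
    simpa only [Finset.sum_fn] using! IntervalIntegrable.sum Finset.univ fun q _ => h p q]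
  refine Finset.sum_congr rfl fun p _ => ?_
  rw [intervalIntegral.integral_finsetSum fun q _ => h p q]
  refine Finset.sum_congr rfl fun q _ => ?_
  rw [intervalIntegral.integral_const_mul, integral_mul_div_lineMap (ha p) (hb q)]

theorem spectral_decomposition {d : Type*} [Fintype d] [DecidableEq d] {A : Matrix d d ℂ}
    (hA : A.IsHermitian) :
    A = (hA.eigenvectorUnitary : Matrix d d ℂ) * diagonal (fun i => (hA.eigenvalues i : ℂ)) *
      (hA.eigenvectorUnitary : Matrix d d ℂ)ᴴ := by
  conv_lhs => rw [hA.spectral_theorem, Unitary.conjStarAlgAut_apply]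
  rfl

theorem sum_normSq_mul {d : Type*} [Fintype d] [DecidableEq d] (W : Matrix d d ℂ) (a : d → ℝ)
    (q : d) :
    ∑ p, Complex.normSq (W p q) * a p = ((Wᴴ * diagonal (fun i => (a i : ℂ)) * W) q q).re := by
  rw [mul_apply, Complex.re_sum]
  refine Finset.sum_congr rfl fun p _ => ?_
  simp [mul_diagonal, Complex.normSq_apply]
  ring

theorem sum_normSq_left {d : Type*} [Fintype d] [DecidableEq d] {W : Matrix d d ℂ}
    (hW : Wᴴ * W = 1) (q : d) : ∑ p, Complex.normSq (W p q) = 1 := by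
  simpa [hW] using sum_normSq_mul W (fun _ => 1) q

theorem sum_normSq_right {d : Type*} [Fintype d] [DecidableEq d] {W : Matrix d d ℂ}
    (hW : Wᴴ * W = 1) (p : d) : ∑ q, Complex.normSq (W p q) = 1 := by
  simpa [Complex.normSq_conj] using
    sum_normSq_left (W := Wᴴ) (by simpa using mul_eq_one_comm.mp hW) p

theorem sum_normSq_mul_relEntropy {d : Type*} [Fintype d] [DecidableEq d] {W : Matrix d d ℂ}
    (hW : Wᴴ * W = 1) (a b : d → ℝ) :
    ∑ p, ∑ q, Complex.normSq (W p q) *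
        (a p * Real.log (a p) - a p * Real.log (b q) - (a p - b q)) =
      ∑ p, a p * Real.log (a p) - ∑ q, (∑ p, Complex.normSq (W p q) * a p) * Real.log (b q)
        - (∑ p, a p - ∑ q, b q) := by
  simp only [mul_sub, Finset.sum_sub_distrib, ← Finset.sum_mul, sum_normSq_right hW, one_mul]
  congr 2
  · rw [Finset.sum_comm]
    simp only [Finset.sum_mul, mul_assoc]
  · rw [Finset.sum_comm]
    simp only [← Finset.sum_mul, sum_normSq_left hW, one_mul]

section

variable {m n : ℕ}

theorem partialTrace_combo (x y : ℝ) (ρ σ : Matrix (Fin m × Fin n) (Fin m × Fin n) ℂ) :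
    partialTrace (x • ρ + y • σ) = x • partialTrace ρ + y • partialTrace σ := by
  ext i j
  simp [partialTrace, Finset.sum_add_distrib, Finset.mul_sum]

theorem isHermitian_partialTrace {ρ : Matrix (Fin m × Fin n) (Fin m × Fin n) ℂ}
    (hρ : ρ.IsHermitian) : (partialTrace ρ).IsHermitian := by
  ext i j
  simp only [partialTrace, conjTranspose_apply, of_apply, star_sum]
  exact Finset.sum_congr rfl fun k _ => hρ.apply _ _

theorem partialTrace_kronecker_mul_mul (ρ : Matrix (Fin m × Fin n) (Fin m × Fin n) ℂ)
    (C D : Matrix (Fin m) (Fin m) ℂ) :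
    partialTrace (kronecker C 1 * ρ * kronecker D 1) = C * partialTrace ρ * D := by
  ext i j
  simp only [partialTrace, of_apply, mul_apply, Fintype.sum_prod_type, kronecker, kroneckerMap_apply,
    one_apply, mul_ite, mul_one, mul_zero, ite_mul, zero_mul, Finset.sum_ite_eq,
    Finset.sum_ite_eq', Finset.mem_univ, if_true, Finset.sum_mul, Finset.mul_sum]
  rw [Finset.sum_comm]
  refine Finset.sum_congr rfl fun _ _ => ?_
  rw [Finset.sum_comm]

/-- The relative entropy of `ρ` with respect to `ρ₁ ⊗ 1`, computed in eigenbases of `ρ` and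
`ρ₁ ⊗ 1`. -/
theorem exists_spectral_integral_eq {ρ : Matrix (Fin m × Fin n) (Fin m × Fin n) ℂ}
    (hρ : ρ.PosDef) :
    ∃ (U V : Matrix (Fin m × Fin n) (Fin m × Fin n) ℂ) (a b : Fin m × Fin n → ℝ),
      Uᴴ * U = 1 ∧ Vᴴ * V = 1 ∧ (∀ p, 0 < a p) ∧ (∀ q, 0 < b q) ∧
      ρ = U * diagonal (fun i => (a i : ℂ)) * Uᴴ ∧
      kronecker (partialTrace ρ) 1 = V * diagonal (fun i => (b i : ℂ)) * Vᴴ ∧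
      ∫ t in (0 : ℝ)..1, t * quadForm t U a V b =
        - trFn (fun t => t * Real.log t) (partialTrace ρ) + trFn (fun t => t * Real.log t) ρ
          + (n - 1) * ρ.trace.re := by
  have hρ₁ := isHermitian_partialTrace hρ.isHermitian
  set U := (hρ.isHermitian.eigenvectorUnitary : Matrix (Fin m × Fin n) (Fin m × Fin n) ℂ)
  set a := hρ.isHermitian.eigenvalues with hadef
  set C := (hρ₁.eigenvectorUnitary : Matrix (Fin m) (Fin m) ℂ)
  set c := hρ₁.eigenvalues with hcdef
  have hU : Uᴴ * U = 1 := Unitary.coe_star_mul_self hρ.isHermitian.eigenvectorUnitary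
  have hC : Cᴴ * C = 1 := Unitary.coe_star_mul_self hρ₁.eigenvectorUnitary
  have hA : ρ = U * diagonal (fun i => (a i : ℂ)) * Uᴴ := spectral_decomposition _
  have hD : partialTrace ρ = C * diagonal (fun i => (c i : ℂ)) * Cᴴ := spectral_decomposition _
  set V : Matrix (Fin m × Fin n) (Fin m × Fin n) ℂ := kronecker C 1 with hVdef
  have hVH : Vᴴ = kronecker Cᴴ 1 := by
    rw [hVdef]
    simp [kronecker, conjTranspose_kronecker]
  have hV : Vᴴ * V = 1 := by
    rw [hVH, hVdef, kronecker, ← mul_kronecker_mul, hC, one_mul, one_kronecker_one]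
  have hB : kronecker (partialTrace ρ) 1 =
      V * diagonal (fun i : Fin m × Fin n => (c i.1 : ℂ)) * Vᴴ := by
    have : diagonal (fun i : Fin m × Fin n => (c i.1 : ℂ)) =
        kronecker (diagonal fun i => (c i : ℂ)) 1 := by
      rw [← diagonal_one, kronecker, diagonal_kronecker_diagonal]
      simp
    rw [this, hVH, hVdef, hD]
    simp only [kronecker, ← mul_kronecker_mul, mul_one]
  have ha (p) : 0 < a p := hρ.eigenvalues_pos p
  have hdiag (i : Fin m) : ∑ k : Fin n, (Vᴴ * ρ * V) (i, k) (i, k) = c i := by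
    have h : Cᴴ * partialTrace ρ * C = diagonal (fun i => (c i : ℂ)) := by
      have : Cᴴ * (C * diagonal (fun i => (c i : ℂ)) * Cᴴ) * C =
          (Cᴴ * C) * diagonal (fun i => (c i : ℂ)) * (Cᴴ * C) := by
        simp only [Matrix.mul_assoc]
      rw [hD, this, hC, Matrix.one_mul, Matrix.mul_one]
    have h' := congrFun₂ (partialTrace_kronecker_mul_mul ρ Cᴴ C) i i
    rw [h, diagonal_apply_eq, ← hVH, ← hVdef] at h'
    exact h'
  have hb (q : Fin m × Fin n) : 0 < c q.1 := by
    have hpos : (Vᴴ * ρ * V).PosDef := hρ.conjTranspose_mul_mul_same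
      (mulVec_injective_of_isUnit (IsUnit.of_mul_eq_one_right _ hV))
    have : (0 : ℂ) < c q.1 := by
      rw [← hdiag]
      exact Finset.sum_pos (fun k _ => hpos.diag_pos) ⟨q.2, Finset.mem_univ _⟩
    exact_mod_cast this
  have hW : (Uᴴ * V)ᴴ * (Uᴴ * V) = 1 := by
    have : (Uᴴ * V)ᴴ * (Uᴴ * V) = Vᴴ * (U * Uᴴ) * V := by
      simp only [conjTranspose_mul, conjTranspose_conjTranspose, Matrix.mul_assoc]
    rw [this, mul_eq_one_comm.mp hU, Matrix.mul_one, hV]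
  have hWA : (Uᴴ * V)ᴴ * diagonal (fun i => (a i : ℂ)) * (Uᴴ * V) = Vᴴ * ρ * V := by
    conv_rhs => rw [hA]
    simp only [conjTranspose_mul, conjTranspose_conjTranspose, Matrix.mul_assoc]
  have htr : ρ.trace.re = ∑ p, a p := by
    rw [hρ.isHermitian.trace_eq_sum_eigenvalues]
    simp [hadef]
  have hsum (i : Fin m) :
      ∑ k : Fin n, ∑ p, Complex.normSq ((Uᴴ * V) p (i, k)) * a p = c i := by
    simp only [sum_normSq_mul, hWA, ← Complex.re_sum, hdiag, Complex.ofReal_re]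
  have htr' : ∑ p, a p = ∑ i, c i := by
    rw [← Finset.sum_congr rfl fun i _ => hsum i, ← Fintype.sum_prod_type'
      (f := fun i k => ∑ p, Complex.normSq ((Uᴴ * V) p (i, k)) * a p), Finset.sum_comm]
    simp only [Prod.mk.eta, ← Finset.sum_mul, sum_normSq_right hW, one_mul]
  have hcard : ∑ q : Fin m × Fin n, c q.1 = n * ∑ i, c i := by
    simp [Fintype.sum_prod_type, Finset.mul_sum]
  refine ⟨U, V, a, fun q => c q.1, hU, hV, ha, hb, hA, hB, ?_⟩
  rw [integral_mul_quadForm U V ha hb, sum_normSq_mul_relEntropy hW a fun q => c q.1, htr,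
    trFn, dif_pos hρ₁, trFn, dif_pos hρ.isHermitian,
    Fintype.sum_prod_type (fun q => (∑ p, _ * a p) * _)]
  simp only [← Finset.sum_mul, hsum, htr', hcard, ← hcdef]
  ring

theorem convexOn_trFn_mul_log_sub_partialTrace :
    ConvexOn ℝ {ρ : Matrix (Fin m × Fin n) (Fin m × Fin n) ℂ | ρ.PosDef}
      (fun ρ => - trFn (fun t => t * Real.log t) (partialTrace ρ) +
        trFn (fun t => t * Real.log t) ρ) := by
  have hconv : Convex ℝ {ρ : Matrix (Fin m × Fin n) (Fin m × Fin n) ℂ | ρ.PosDef} := by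
    refine convex_iff_forall_pos.2 fun ρ hρ σ hσ x y hx hy _ => ?_
    exact (PosDef.smul hρ hx).add (PosDef.smul hσ hy)
  refine ⟨hconv, fun ρ hρ σ hσ x y hx hy hxy => ?_⟩
  obtain ⟨U, V, a, b, hU, hV, ha, hb, hA, hB, hI⟩ := exists_spectral_integral_eq hρ
  obtain ⟨U', V', a', b', hU', hV', ha', hb', hA', hB', hI'⟩ := exists_spectral_integral_eq hσ
  obtain ⟨U'', V'', a'', b'', hU'', hV'', ha'', hb'', hA'', hB'', hI''⟩ :=
    exists_spectral_integral_eq (hconv hρ hσ hx hy hxy)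
  have hle : ∀ t ∈ Set.Icc (0 : ℝ) 1, t * quadForm t U'' a'' V'' b'' ≤
      x * (t * quadForm t U a V b) + y * (t * quadForm t U' a' V' b') := by
    intro t ht
    obtain ⟨Z, hZ⟩ := exists_quadFunctional_eq_quadForm hU'' hV''
      fun p q => pos_lineMap (ha'' p) (hb'' q) ht
    have hk : kronecker (partialTrace (x • ρ + y • σ)) (1 : Matrix (Fin n) (Fin n) ℂ) =
        x • kronecker (partialTrace ρ) 1 + y • kronecker (partialTrace σ) 1 := by
      simp only [partialTrace_combo, kronecker, add_kronecker, smul_kronecker]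
    rw [← hA'', ← hB'', hk, quadFunctional_combo] at hZ
    have h1 := quadFunctional_le_quadForm hU hV (fun p q => pos_lineMap (ha p) (hb q) ht) Z
    have h2 := quadFunctional_le_quadForm hU' hV' (fun p q => pos_lineMap (ha' p) (hb' q) ht) Z
    rw [← hA, ← hB] at h1
    rw [← hA', ← hB'] at h2
    rw [← hZ]
    calc t * (x * quadFunctional t Z ρ (kronecker (partialTrace ρ) 1) +
          y * quadFunctional t Z σ (kronecker (partialTrace σ) 1))
        ≤ t * (x * quadForm t U a V b + y * quadForm t U' a' V' b') := by
          have := ht.1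
          gcongr
      _ = _ := by ring
  have hi := (intervalIntegrable_mul_quadForm U V ha hb).const_mul x
  have hi' := (intervalIntegrable_mul_quadForm U' V' ha' hb').const_mul y
  have hmono := intervalIntegral.integral_mono_on zero_le_one
    (intervalIntegrable_mul_quadForm U'' V'' ha'' hb'') (hi.add hi') hle
  rw [intervalIntegral.integral_add hi hi', intervalIntegral.integral_const_mul,
    intervalIntegral.integral_const_mul, hI, hI', hI''] at hmono
  simp only [trace_add, trace_smul, Complex.add_re, Complex.smul_re, smul_eq_mul] at hmono ⊢
  linarith

end

/-- The function `f(t) = t·log t` is entropic: on every finite-dimensional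
bipartite system the map `ρ ↦ -Tr(ρ₁ log ρ₁) + Tr(ρ log ρ)` is convex in positive
definite `ρ`, i.e. the conditional von Neumann entropy `S(ρ) - S(ρ₁)` is concave. -/
theorem vonNeumann_entropy_is_entropic :
    IsEntropic (fun t => t * Real.log t) := by
  exact ⟨Real.convexOn_mul_log.subset Set.Ioi_subset_Ici_self (convex_Ioi 0),
    fun _ _ => convexOn_trFn_mul_log_sub_partialTrace⟩

end
end
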